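/- arXiv:2308.13361 — 2 statements merged into one kernel-verified Lean document; each statement's English description precedes it below -/
import Mathlib

section
/- Let p ∈ [1,∞), suppose X is internally doubling and supports an internal p-Poincaré inequality. Let Ω ⊆ X be open, (Y,d_Y) a metric space, and f ∈ L^p_loc(Ω,Y) ∩ S^{1,p}(Ω,Y). Suppose there exists a Borel function e : Ω → [0,∞) such that for m-a.e. x ∈ Ω one can find Borel sets V_{x,n} ⊆ Ω (n ∈ ℕ), each having x as a density point, with limsup_{n→∞} limsup_{r↘0} |ks_p[f,V_{x,n}](x,r) − e(x)| = 0. Then e is the p-energy density of f; that is, for every open Ω' ⋐ Ω, e ∈ L¹(Ω') and the functions ks_p[f,Ω](·,r) converge to e, both in L¹(Ω') and m-a.e. on Ω', as r ↘ 0. -/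
open MeasureTheory Filter Metric Set Topology
open scoped ENNReal NNReal

noncomputable section

namespace BBM

variable {X : Type*} [MetricSpace X]

/-- The closed `r`-neighborhood of a set `S`: the set of points at distance at most `r`
from `S`. -/
def setBall (S : Set X) (r : ℝ) : Set X :=
  {x : X | EMetric.infEdist x S ≤ ENNReal.ofReal r}

/-- The (extended) distance, computed in the metric completion `X̄` of `X`, from a set
`S ⊆ X` to the complement `X̄ \ S₀` of a set `S₀ ⊆ X`. -/
def compDist (S S₀ : Set X) : ℝ≥0∞ :=
  ⨅ (x : X) (_ : x ∈ S) (z : UniformSpace.Completion X)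
    (_ : z ∉ (fun a : X => (a : UniformSpace.Completion X)) '' S₀),
    edist (x : UniformSpace.Completion X) z

/-- `S ⋐ S₀` : the set `S` is well contained in `S₀`, i.e. `S ⊆ S₀` and the distance
from `S` to `X̄ \ S₀` (computed in the completion `X̄`) is positive. -/
def WellInside (S S₀ : Set X) : Prop := S ⊆ S₀ ∧ 0 < compDist S S₀

/-- The local Lipschitz constant (slope) of `u` at `x`, relative to the domain `Ω`.
If `x` is not a limit point of `Ω`, the filter below is trivial and the value is `0`. -/
def lipAt (Ω : Set X) (u : X → ℝ) (x : X) : ℝ≥0∞ :=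
  Filter.limsup (fun x' => ENNReal.ofReal (|u x' - u x| / dist x' x)) (𝓝[Ω \ {x}] x)

/-- `u` is locally Lipschitz on `Ω`: each point of `Ω` has a closed ball inside `Ω`
on which `u` is Lipschitz. -/
def LocLipschitzOn (Ω : Set X) (u : X → ℝ) : Prop :=
  ∀ x ∈ Ω, ∃ r > 0, ∃ K : NNReal, closedBall x r ⊆ Ω ∧ LipschitzOnWith K u (closedBall x r)

variable [MeasurableSpace X]

/-- `u ∈ L^p_loc(E)` : `u` is Borel and `p`-integrable near every point of `E`. -/
def MemLpLocOn (m : Measure X) (p : ℝ) (E : Set X) (u : X → ℝ) : Prop :=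
  Measurable u ∧ ∀ x ∈ E, ∃ r > 0,
    ∫⁻ x' in E ∩ closedBall x r, ENNReal.ofReal |u x'| ^ p ∂m < ⊤

/-- Convergence of a sequence `v n` to `u` in `L^p_loc(E)`. -/
def TendstoLpLoc (m : Measure X) (p : ℝ) (E : Set X) (v : ℕ → X → ℝ) (u : X → ℝ) : Prop :=
  ∀ x ∈ E, ∃ r > 0,
    Tendsto (fun n => ∫⁻ x' in E ∩ closedBall x r, ENNReal.ofReal |v n x' - u x'| ^ p ∂m)
      atTop (𝓝 0)

/-- Cheeger `p`-energy of a real valued function on an open set `Ω'`, defined by relaxation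
along sequences of locally Lipschitz functions converging in `L^p_loc(Ω')`. -/
def cheegerOpen (m : Measure X) (p : ℝ) (u : X → ℝ) (Ω' : Set X) : ℝ≥0∞ :=
  ⨅ (v : ℕ → X → ℝ) (_ : ∀ n, LocLipschitzOn Ω' (v n)) (_ : TendstoLpLoc m p Ω' v u),
    Filter.liminf (fun n => ∫⁻ x in Ω', lipAt Ω' (v n) x ^ p ∂m) atTop

/-- Cheeger `p`-energy of a real valued function on an arbitrary subset `S` of `Ω`:
infimum over open sets `Ω'` with `S ⊆ Ω' ⊆ Ω`. -/
def cheegerSet (m : Measure X) (p : ℝ) (Ω : Set X) (u : X → ℝ) (S : Set X) : ℝ≥0∞ :=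
  ⨅ (Ω' : Set X) (_ : IsOpen Ω') (_ : Ω' ⊆ Ω) (_ : S ⊆ Ω'), cheegerOpen m p u Ω'

/-- `φ` is a bounded `1`-Lipschitz real function. -/
def BddLip1 {Y : Type*} [PseudoMetricSpace Y] (φ : Y → ℝ) : Prop :=
  (∃ C, ∀ y, |φ y| ≤ C) ∧ LipschitzWith 1 φ

/-- `ν` is a Borel-regular outer measure: Borel sets are Carathéodory-measurable and every
set is contained in a Borel set with the same measure. -/
def IsBorelRegularOM (ν : OuterMeasure X) : Prop :=
  (∀ B : Set X, MeasurableSet B → ν.IsCaratheodory B) ∧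
  ∀ S : Set X, ∃ B : Set X, MeasurableSet B ∧ S ⊆ B ∧ ν S = ν B

/-- `ν` is the Cheeger `p`-energy of the metric-space-valued map `f` on `Ω`: the least
Borel-regular outer measure dominating `S ↦ E_p[φ ∘ f](S)` for all bounded `1`-Lipschitz
`φ : Y → ℝ` and all `S ⊆ Ω`. -/
def IsCheegerEnergy (m : Measure X) (p : ℝ) (Ω : Set X) {Y : Type*} [MetricSpace Y]
    (f : X → Y) (ν : OuterMeasure X) : Prop :=
  IsBorelRegularOM ν ∧
  (∀ S, S ⊆ Ω → ∀ φ : Y → ℝ, BddLip1 φ → cheegerSet m p Ω (φ ∘ f) S ≤ ν S) ∧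
  ∀ ν' : OuterMeasure X, IsBorelRegularOM ν' →
    (∀ S, S ⊆ Ω → ∀ φ : Y → ℝ, BddLip1 φ → cheegerSet m p Ω (φ ∘ f) S ≤ ν' S) →
    ∀ S, S ⊆ Ω → ν S ≤ ν' S

/-- `f ∈ 𝔅(E, Y)` : `f` is Borel (w.r.t. the Borel σ-algebra of `Y`) on `E` and essentially
separably valued on `E`. -/
def MemB (m : Measure X) (E : Set X) {Y : Type*} [MetricSpace Y] (f : X → Y) : Prop :=
  (@Measurable E Y _ (borel Y) fun x : E => f x) ∧
  ∃ N : Set X, N ⊆ E ∧ m N = 0 ∧ TopologicalSpace.IsSeparable (f '' (E \ N))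

/-- `f ∈ L^p(E, Y)`. -/
def MemLpY (m : Measure X) (p : ℝ) (E : Set X) {Y : Type*} [MetricSpace Y] (f : X → Y) :
    Prop :=
  MemB m E f ∧ ∃ y : Y, ∫⁻ x in E, edist (f x) y ^ p ∂m < ⊤

/-- `f ∈ L^p_loc(E, Y)`. -/
def MemLpLocY (m : Measure X) (p : ℝ) (E : Set X) {Y : Type*} [MetricSpace Y] (f : X → Y) :
    Prop :=
  MemB m E f ∧ ∃ y : Y, ∀ x ∈ E, ∃ r > 0,
    ∫⁻ x' in E ∩ closedBall x r, edist (f x') y ^ p ∂m < ⊤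

/-- `f ∈ S^{1,p}(Ω, Y)` : `f ∈ 𝔅(Ω,Y)`, the Cheeger `p`-energy of `f` is finite on `Ω` and
absolutely continuous with respect to `m` restricted to `Ω`. -/
def MemSobolevClass (m : Measure X) (p : ℝ) (Ω : Set X) {Y : Type*} [MetricSpace Y]
    (f : X → Y) : Prop :=
  MemB m Ω f ∧ ∃ ν : OuterMeasure X, IsCheegerEnergy m p Ω f ν ∧ ν Ω < ⊤ ∧
    ∀ S, S ⊆ Ω → m S = 0 → ν S = 0

/-- The doubling property on the `R`-neighborhood of `S`, at scales up to `R`. -/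
def DoublingOn (m : Measure X) (C_D : NNReal) (S : Set X) (R : ℝ) : Prop :=
  ∀ x ∈ setBall S R, ∀ r : ℝ, 0 < r → r ≤ R →
    0 < m (closedBall x (2 * r)) ∧
    m (closedBall x (2 * r)) ≤ (C_D : ℝ≥0∞) * m (closedBall x r) ∧
    m (closedBall x r) < ⊤

/-- `X` is internally doubling with constant `C_D`. -/
def InternallyDoubling (m : Measure X) (C_D : NNReal) : Prop :=
  1 ≤ C_D ∧ ∀ S : Set X, WellInside S univ → ∃ R > 0, DoublingOn m C_D S R

/-- The `p`-Poincaré property on the `R`-neighborhood of `S`, at scales up to `R`. -/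
def PoincareOn (m : Measure X) (p C_P lam : ℝ) (S : Set X) (R : ℝ) : Prop :=
  (∀ x ∈ setBall S R, ∀ r : ℝ, 0 < r → r ≤ lam * R →
      0 < m (closedBall x r) ∧ m (closedBall x r) < ⊤) ∧
  ∀ u : X → ℝ, (∃ K : NNReal, LipschitzWith K u) →
    ∀ x ∈ setBall S R, ∀ r : ℝ, 0 < r → r ≤ R →
      (m (closedBall x r))⁻¹ *
          ∫⁻ x' in closedBall x r,
            ENNReal.ofReal |u x' - ⨍ x'' in closedBall x r, u x'' ∂m| ∂m ≤
        ENNReal.ofReal (C_P * r) *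
          ((m (closedBall x (lam * r)))⁻¹ *
              ∫⁻ x' in closedBall x (lam * r), lipAt univ u x' ^ p ∂m) ^ (1 / p)

/-- `X` supports an internal `p`-Poincaré inequality with constants `C_P`, `lam`. -/
def InternalPoincare (m : Measure X) (p C_P lam : ℝ) : Prop :=
  0 < C_P ∧ 1 ≤ lam ∧ ∀ S : Set X, WellInside S univ → ∃ R > 0, PoincareOn m p C_P lam S R

/-- `σ(δ, x, r)` : supremum of `ρ δ x ·` outside the closed ball `B(x,r)` (zero if the
complement is empty). -/
def sigmaM (ρ : ℝ → X → X → NNReal) (δ : ℝ) (x : X) (r : ℝ) : ℝ≥0∞ :=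
  ⨆ x' ∈ (closedBall x r)ᶜ, (ρ δ x x' : ℝ≥0∞)

/-- Absolute difference in `ℝ≥0∞`. -/
def eabs (a b : ℝ≥0∞) : ℝ≥0∞ := (a - b) ⊔ (b - a)

/-- The quantities `Π_{L,k}(δ,x,r,h)`. -/
def PiL (m : Measure X) (ρ : ℝ → X → X → NNReal) (p δ : ℝ) (x : X) (r h : ℝ) : ℕ → ℝ≥0∞
  | 0 => sigmaM ρ δ x r * m (closedBall x (r / h)) * ENNReal.ofReal (r / h) ^ p
  | k + 1 =>
      eabs (sigmaM ρ δ x (r / h ^ (k + 1))) (sigmaM ρ δ x (r / h ^ k)) *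
        m (closedBall x (r / h ^ (k + 2))) * ENNReal.ofReal (r / h ^ (k + 2)) ^ p

/-- The quantities `Π_{U,k}(δ,x,r,h)`. -/
def PiU (m : Measure X) (ρ : ℝ → X → X → NNReal) (p δ : ℝ) (x : X) (r h : ℝ) : ℕ → ℝ≥0∞
  | 0 => sigmaM ρ δ x r * m (closedBall x r) * ENNReal.ofReal r ^ p
  | k + 1 =>
      eabs (sigmaM ρ δ x (r / h ^ (k + 1))) (sigmaM ρ δ x (r / h ^ k)) *
        m (closedBall x (r / h ^ (k + 1))) * ENNReal.ofReal (r / h ^ (k + 1)) ^ p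

/-- The family `(ρ_δ)_{δ ∈ (0,1)}` is `p`-admissible with constant `C_M`. -/
def PAdmissible (m : Measure X) (p : ℝ) (ρ : ℝ → X → X → NNReal) (C_M : NNReal) : Prop :=
  (∀ δ ∈ Ioo (0:ℝ) 1, Measurable fun q : X × X => ρ δ q.1 q.2) ∧
  (Filter.limsup (fun r : ℝ => Filter.limsup (fun δ : ℝ =>
      ⨆ x : X, ∫⁻ x' in (closedBall x r)ᶜ, ((ρ δ x x' : ℝ≥0∞) + (ρ δ x' x : ℝ≥0∞)) ∂m)
      (𝓝[>] (0:ℝ))) (𝓝[>] (0:ℝ)) = 0) ∧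
  (∀ x : X, Filter.limsup (fun r : ℝ => Filter.limsup (fun δ : ℝ => sigmaM ρ δ x r)
      (𝓝[>] (0:ℝ))) (𝓝[>] (0:ℝ)) = 0) ∧
  (∀ δ ∈ Ioo (0:ℝ) 1, ∀ x x₁ x₂ : X, dist x x₁ ≤ dist x x₂ → ρ δ x x₂ ≤ ρ δ x x₁) ∧
  (∀ x : X, ∀ δ ∈ Ioo (0:ℝ) 1,
      Filter.limsup (fun r : ℝ => sigmaM ρ δ x r * m (closedBall x r) * ENNReal.ofReal r ^ p)
        (𝓝[>] (0:ℝ)) = 0) ∧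
  1 ≤ C_M ∧
  ∀ S : Set X, S.Nonempty → WellInside S univ →
    ((C_M : ℝ≥0∞))⁻¹ ≤ Filter.liminf (fun r : ℝ => Filter.liminf (fun δ : ℝ =>
        ∑' k, ⨅ x ∈ S, PiL m ρ p δ x r 2 k) (𝓝[>] (0:ℝ))) (𝓝[>] (0:ℝ)) ∧
    Filter.limsup (fun r : ℝ => Filter.limsup (fun δ : ℝ =>
        ∑' k, ⨆ x ∈ S, PiU m ρ p δ x r 2 k) (𝓝[>] (0:ℝ))) (𝓝[>] (0:ℝ)) ≤ (C_M : ℝ≥0∞)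

/-- The family `(ρ_δ)_{δ ∈ (0,1)}` is strongly `p`-admissible with constant `C_M` and
function `Θ`. -/
def StronglyPAdmissible (m : Measure X) (p : ℝ) (ρ : ℝ → X → X → NNReal) (C_M : NNReal)
    (Θ : X → ℝ≥0∞) : Prop :=
  PAdmissible m p ρ C_M ∧
  (∀ S : Set X, S.Nonempty → WellInside S univ → ∀ h : ℝ, 1 < h →
      Filter.limsup (fun r : ℝ => Filter.limsup (fun δ : ℝ =>
          ∑' k, ⨆ x ∈ S, PiU m ρ p δ x r h k) (𝓝[>] (0:ℝ))) (𝓝[>] (0:ℝ)) < ⊤) ∧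
  Measurable Θ ∧ (∀ x, Θ x < ⊤) ∧
  Filter.limsup (fun h : ℝ => essSup (fun x : X =>
      Filter.limsup (fun r : ℝ => Filter.limsup (fun δ : ℝ =>
          eabs (Θ x) (∑' k, PiL m ρ p δ x r h k) + eabs (Θ x) (∑' k, PiU m ρ p δ x r h k))
        (𝓝[>] (0:ℝ))) (𝓝[>] (0:ℝ))) m) (𝓝[>] (1:ℝ)) = 0

/-- The Korevaar–Schoen approximate `p`-energy density `ks_p[f,E](x,r)`. -/
def ks (m : Measure X) (p : ℝ) {Y : Type*} [PseudoEMetricSpace Y] (f : X → Y) (E : Set X)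
    (x : X) (r : ℝ) : ℝ≥0∞ :=
  (m (closedBall x r))⁻¹ *
    ∫⁻ x' in closedBall x r ∩ E, edist (f x) (f x') ^ p / ENNReal.ofReal r ^ p ∂m

/-- The averaging operator `A_p[f](x,r)` applied to an energy (outer) measure `ν`. -/
def Aop (m : Measure X) (ν : OuterMeasure X) (x : X) (r : ℝ) : ℝ≥0∞ :=
  if m (closedBall x r) = 0 then 0 else ν (closedBall x r) / m (closedBall x r)

/-- The (modified) Riesz potential `R_p[f](x,r)` applied to an energy measure `ν`. -/
def Rop (m : Measure X) (ν : OuterMeasure X) (x : X) (r : ℝ) : ℝ≥0∞ :=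
  (3 : ℝ≥0∞)⁻¹ * ∑' k : ℕ, (2 / 3 : ℝ≥0∞) ^ k * Aop m ν x (r / 2 ^ k)

/-- The maximal function `M_p[f](x,r)` applied to an energy measure `ν`. -/
def Mop (m : Measure X) (ν : OuterMeasure X) (x : X) (r : ℝ) : ℝ≥0∞ :=
  ⨆ r' ∈ Ioc (0:ℝ) r, Aop m ν x r'

/-- `x` is a density point of `E` (and lies in the support of `m`). -/
def IsDensityPoint (m : Measure X) (E : Set X) (x : X) : Prop :=
  (∀ r : ℝ, 0 < r → 0 < m (ball x r)) ∧
  Tendsto (fun r : ℝ => m (E ∩ closedBall x r) / m (closedBall x r)) (𝓝[>] (0:ℝ)) (𝓝 1)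

/-- `f` has the Luzin–Lipschitz property on `E`. -/
def LuzinLipschitzOn (m : Measure X) (E : Set X) {Y : Type*} [PseudoEMetricSpace Y]
    (f : X → Y) : Prop :=
  ∃ E' : ℕ → Set X, (∀ k, MeasurableSet (E' k) ∧ E' k ⊆ E) ∧ m (E \ ⋃ k, E' k) = 0 ∧
    ∀ k, ∃ K : NNReal, LipschitzOnWith K f (E' k)

/-- A strongly rectifiable atlas with accuracy `ε`: pieces `U i`, dimensions `d i`,
`(1+ε)`-biLipschitz charts `ψ i`, and pushforward measures equal to `c i · θ i · Lebesgue`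
on the chart images. -/
def RectAtlas (m : Measure X) (ε : ℝ) (d : ℕ → ℕ) (U : ℕ → Set X)
    (ψ : (i : ℕ) → X → EuclideanSpace ℝ (Fin (d i))) (c : ℕ → ℝ)
    (θ : (i : ℕ) → EuclideanSpace ℝ (Fin (d i)) → ℝ) : Prop :=
  (∀ i, MeasurableSet (U i)) ∧ Pairwise (Function.onFun Disjoint U) ∧
  m (Set.univ \ ⋃ i, U i) = 0 ∧
  (∀ i, ∀ x ∈ U i, ∀ y ∈ U i,
      dist x y ≤ (1 + ε) * dist (ψ i x) (ψ i y) ∧ dist (ψ i x) (ψ i y) ≤ (1 + ε) * dist x y) ∧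
  (∀ i, 0 < c i) ∧ (∀ i, Measurable (θ i)) ∧ (∀ i v, θ i v ∈ Set.Icc (1 + ε)⁻¹ (1 + ε)) ∧
  ∀ i, ∀ A : Set (EuclideanSpace ℝ (Fin (d i))), MeasurableSet A →
    m (U i ∩ ψ i ⁻¹' A) = ∫⁻ v in A ∩ ψ i '' U i, ENNReal.ofReal (c i * θ i v)

/-- `X` (with measure `m`) is strongly rectifiable. -/
def StronglyRectifiable (m : Measure X) : Prop :=
  ∀ ε ∈ Ioo (0:ℝ) 1, ∃ d U ψ c θ, RectAtlas m ε d U ψ c θ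

/-- `Dim` is a dimensional decomposition function for the strongly rectifiable space `X`. -/
def IsDimensionFunction (m : Measure X) (Dim : X → ℕ) : Prop :=
  Measurable Dim ∧ ∀ ε ∈ Ioo (0:ℝ) 1, ∃ d U ψ c θ, RectAtlas m ε d U ψ c θ ∧
    ∀ i, m {x ∈ U i | Dim x ≠ d i} = 0

/-- The data of a good extension: `ι` is an isometric embedding of `Y` into `Z` and
`F ∈ L^p(X, Z)` has finite Cheeger `p`-energy `ν` on `X`, coincides `m`-a.e. on `Ω`
with `ι ∘ f`, and `E_p[F](B(Ω,r)) → E_p[F](Ω)` as `r ↘ 0`. -/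
def IsGoodExtension (m : Measure X) (p : ℝ) (Ω : Set X) {Y : Type*} [MetricSpace Y]
    {Z : Type*} [MetricSpace Z] (f : X → Y) (ι : Y → Z) (F : X → Z) : Prop :=
  Isometry ι ∧ MemLpY m p Set.univ F ∧
  ∃ ν : OuterMeasure X, IsCheegerEnergy m p Set.univ F ν ∧ ν Set.univ < ⊤ ∧
    (∀ᵐ x ∂m.restrict Ω, F x = ι (f x)) ∧
    Tendsto (fun r : ℝ => ν (setBall Ω r)) (𝓝[>] (0:ℝ)) (𝓝 (ν Ω))

/-- The open set `Ω` has the strong `p`-extension property. -/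
def StrongPExtension (m : Measure X) (p : ℝ) (Ω : Set X) : Prop :=
  ∀ (Y : Type) [MetricSpace Y] (f : X → Y),
    MemLpY m p Ω f → (∃ ν : OuterMeasure X, IsCheegerEnergy m p Ω f ν ∧ ν Ω < ⊤) →
    ∃ (Z : Type) (iZ : MetricSpace Z) (ι : Y → Z) (F : X → Z),
      @IsGoodExtension X _ _ m p Ω Y _ Z iZ f ι F


set_option linter.unusedSectionVars false
set_option linter.deprecated false

/-! ### Averages and Riesz-type potentials -/

/-- The average of a measure `μ` over a closed ball, relative to `m`. -/
def avg (m μ : Measure X) (x : X) (s : ℝ) : ℝ≥0∞ :=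
  (m (closedBall x s))⁻¹ * μ (closedBall x s)

/-- A Riesz-type potential of a measure. -/
def HH (m μ : Measure X) (x : X) (t : ℝ) : ℝ≥0∞ :=
  ∑' k : ℕ, (3 / 4 : ℝ≥0∞) ^ k * avg m μ x (t / 2 ^ k)

lemma tsum_three_quarters : ∑' k : ℕ, (3 / 4 : ℝ≥0∞) ^ k = 4 := by
  rw [ENNReal.tsum_geometric]
  have h : (3 / 4 : ℝ≥0∞) = ENNReal.ofReal (3 / 4) := by
    rw [ENNReal.ofReal_div_of_pos (by norm_num)]; norm_num
  rw [h, ← ENNReal.ofReal_one, ← ENNReal.ofReal_sub _ (by norm_num),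
    ← ENNReal.ofReal_inv_of_pos (by norm_num)]
  norm_num

lemma HH_le_of_avg_le {m μ : Measure X} {x : X} {t : ℝ} {M : ℝ≥0∞}
    (h : ∀ k : ℕ, avg m μ x (t / 2 ^ k) ≤ M) : HH m μ x t ≤ 4 * M := by
  unfold HH
  calc ∑' k : ℕ, (3 / 4 : ℝ≥0∞) ^ k * avg m μ x (t / 2 ^ k)
      ≤ ∑' k : ℕ, (3 / 4 : ℝ≥0∞) ^ k * M := by
        apply ENNReal.tsum_le_tsum; intro k; gcongr; exact h k
    _ = 4 * M := by rw [ENNReal.tsum_mul_right, tsum_three_quarters]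

lemma avg_add (m μ₁ μ₂ : Measure X) (x : X) (s : ℝ) :
    avg m (μ₁ + μ₂) x s = avg m μ₁ x s + avg m μ₂ x s := by
  simp [avg, mul_add]

lemma HH_add (m μ₁ μ₂ : Measure X) (x : X) (s : ℝ) :
    HH m (μ₁ + μ₂) x s = HH m μ₁ x s + HH m μ₂ x s := by
  simp [HH, avg_add, mul_add, ENNReal.tsum_add]

lemma avg_mono_of_le {m μ₁ μ₂ : Measure X} {x : X} {s : ℝ}
    (h : μ₁ (closedBall x s) ≤ μ₂ (closedBall x s)) : avg m μ₁ x s ≤ avg m μ₂ x s := by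
  unfold avg; gcongr

lemma HH_mono_of_le {m μ₁ μ₂ : Measure X} {x : X} {t : ℝ}
    (h : ∀ k : ℕ, μ₁ (closedBall x (t / 2 ^ k)) ≤ μ₂ (closedBall x (t / 2 ^ k))) :
    HH m μ₁ x t ≤ HH m μ₂ x t := by
  unfold HH
  apply ENNReal.tsum_le_tsum; intro k; gcongr; exact avg_mono_of_le (h k)

section
variable [BorelSpace X] [SecondCountableTopology X]

lemma measurable_measure_closedBall (μ : Measure X) [SFinite μ] (s : ℝ) :
    Measurable fun x => μ (closedBall x s) := by
  have hs : MeasurableSet {q : X × X | dist q.2 q.1 ≤ s} :=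
    (isClosed_le (by fun_prop) continuous_const).measurableSet
  exact measurable_measure_prodMk_left hs

lemma measurable_avg (m μ : Measure X) [SFinite μ] [SFinite m] (s : ℝ) :
    Measurable fun x => avg m μ x s :=
  (measurable_measure_closedBall m s).inv.mul (measurable_measure_closedBall μ s)

lemma measurable_HH (m μ : Measure X) [SFinite μ] [SFinite m] (s : ℝ) :
    Measurable fun x => HH m μ x s := by
  unfold HH
  exact Measurable.ennreal_tsum fun k => (measurable_avg m μ _).const_mul _

lemma ennreal_inv_le_of_le_mul {a b C : ℝ≥0∞} (hC0 : C ≠ 0) (hC : C ≠ ⊤) (h : a ≤ C * b) :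
    b⁻¹ ≤ C * a⁻¹ := by
  have h1 : (C * b)⁻¹ ≤ a⁻¹ := ENNReal.inv_le_inv.2 h
  rw [ENNReal.mul_inv (Or.inl hC0) (Or.inl hC)] at h1
  calc b⁻¹ = C * (C⁻¹ * b⁻¹) := by
        rw [← mul_assoc, ENNReal.mul_inv_cancel hC0 hC, one_mul]
    _ ≤ C * a⁻¹ := by gcongr

/-- The averaging operator is bounded on `L¹`. -/
lemma lintegral_avg_le (m μ : Measure X) [SFinite μ] [SFinite m] (s : ℝ) (E : Set X)
    (hE : MeasurableSet E) {C : ℝ≥0∞} (hC0 : C ≠ 0) (hC : C ≠ ⊤)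
    (h : ∀ x ∈ E, m (closedBall x (2 * s)) ≤ C * m (closedBall x s)) :
    ∫⁻ x in E, avg m μ x s ∂m ≤ C * μ univ := by
  have hset : MeasurableSet {q : X × X | dist q.2 q.1 ≤ s} :=
    (isClosed_le (by fun_prop) continuous_const).measurableSet
  set K : X × X → ℝ≥0∞ := fun q =>
    {q : X × X | dist q.2 q.1 ≤ s}.indicator (fun q => (m (closedBall q.1 s))⁻¹) q with hK
  have hKm : Measurable K :=
    (((measurable_measure_closedBall m s).comp measurable_fst).inv).indicator hset
  have h1 : ∀ x, avg m μ x s = ∫⁻ y, K (x, y) ∂μ := by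
    intro x
    have : (fun y => K (x, y)) =
        (closedBall x s).indicator (fun _ => (m (closedBall x s))⁻¹) := by
      ext y
      simp only [hK, indicator, mem_setOf_eq, mem_closedBall]
    rw [this, lintegral_indicator_const measurableSet_closedBall, avg]
  simp_rw [h1]
  rw [lintegral_lintegral_swap (by exact hKm.aemeasurable)]
  calc ∫⁻ y, ∫⁻ x in E, K (x, y) ∂m ∂μ ≤ ∫⁻ _, C ∂μ := by
        apply lintegral_mono
        intro y
        calc ∫⁻ x in E, K (x, y) ∂m
            ≤ ∫⁻ x in E, (closedBall y s).indicator
                (fun _ => C * (m (closedBall y s))⁻¹) x ∂m := by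
              apply setLIntegral_mono_ae' hE
              filter_upwards with x hx
              simp only [hK, indicator, mem_setOf_eq, mem_closedBall]
              rw [dist_comm x y]
              split_ifs with hd
              · apply ennreal_inv_le_of_le_mul hC0 hC
                refine le_trans (measure_mono ?_) (h x hx)
                apply closedBall_subset_closedBall'
                linarith
              · exact le_rfl
          _ ≤ ∫⁻ x, (closedBall y s).indicator
                (fun _ => C * (m (closedBall y s))⁻¹) x ∂m := setLIntegral_le_lintegral _ _
          _ = C * ((m (closedBall y s))⁻¹ * m (closedBall y s)) := by
              rw [lintegral_indicator_const measurableSet_closedBall, mul_assoc]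
          _ ≤ C * 1 := by gcongr; exact ENNReal.inv_mul_le_one _
          _ = C := mul_one C
    _ = C * μ univ := by rw [lintegral_const]

lemma lintegral_HH_le (m μ : Measure X) [SFinite μ] [SFinite m] (t : ℝ) (E : Set X)
    (hE : MeasurableSet E) {C : ℝ≥0∞} (hC0 : C ≠ 0) (hC : C ≠ ⊤)
    (h : ∀ x ∈ E, ∀ k : ℕ,
      m (closedBall x (2 * (t / 2 ^ k))) ≤ C * m (closedBall x (t / 2 ^ k))) :
    ∫⁻ x in E, HH m μ x t ∂m ≤ 4 * (C * μ univ) := by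
  unfold HH
  rw [lintegral_tsum fun k => ((measurable_avg m μ _).const_mul _).aemeasurable]
  calc ∑' k : ℕ, ∫⁻ x in E, (3 / 4 : ℝ≥0∞) ^ k * avg m μ x (t / 2 ^ k) ∂m
      ≤ ∑' k : ℕ, (3 / 4 : ℝ≥0∞) ^ k * (C * μ univ) := by
        apply ENNReal.tsum_le_tsum; intro k
        rw [lintegral_const_mul _ (measurable_avg m μ _)]
        gcongr
        exact lintegral_avg_le m μ _ E hE hC0 hC fun x hx => h x hx k
    _ = 4 * (C * μ univ) := by rw [ENNReal.tsum_mul_right, tsum_three_quarters]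

end

/-- The discrete substitute for Jensen's inequality. -/
lemma tsum_rpow_le {p : ℝ} (hp : 1 ≤ p) (a : ℕ → ℝ≥0∞) :
    (∑' k : ℕ, (1 / 2 : ℝ≥0∞) ^ k * a k ^ (1 / p)) ^ p ≤
      (3 : ℝ≥0∞) ^ p * ∑' k : ℕ, (3 / 4 : ℝ≥0∞) ^ k * a k := by
  set M := ∑' k : ℕ, (3 / 4 : ℝ≥0∞) ^ k * a k with hM
  have hp0 : 0 < p := by linarith
  have h1 : ∀ k, a k ≤ (4 / 3 : ℝ≥0∞) ^ k * M := by
    intro k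
    have h2 : (3 / 4 : ℝ≥0∞) ^ k * a k ≤ M := ENNReal.le_tsum k
    have h3 : (4 / 3 : ℝ≥0∞) ^ k * (3 / 4 : ℝ≥0∞) ^ k = 1 := by
      rw [← mul_pow]
      have : (4 / 3 : ℝ≥0∞) * (3 / 4) = 1 := by
        rw [← ENNReal.inv_div (by simp) (by simp), ENNReal.inv_mul_cancel]
        · simp
        · simp [ENNReal.div_eq_top]
      rw [this, one_pow]
    calc a k = (4 / 3 : ℝ≥0∞) ^ k * ((3 / 4 : ℝ≥0∞) ^ k * a k) := by
          rw [← mul_assoc, h3, one_mul]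
      _ ≤ _ := by gcongr
  have h4 : ∀ k, a k ^ (1 / p) ≤ (4 / 3 : ℝ≥0∞) ^ k * M ^ (1 / p) := by
    intro k
    calc a k ^ (1 / p) ≤ ((4 / 3 : ℝ≥0∞) ^ k * M) ^ (1 / p) := by
          apply ENNReal.rpow_le_rpow (h1 k); positivity
      _ = ((4 / 3 : ℝ≥0∞) ^ k) ^ (1 / p) * M ^ (1 / p) := by
          rw [ENNReal.mul_rpow_of_nonneg _ _ (by positivity)]
      _ ≤ ((4 / 3 : ℝ≥0∞) ^ k) ^ (1 : ℝ) * M ^ (1 / p) := by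
          gcongr
          · apply one_le_pow₀
            rw [ENNReal.le_div_iff_mul_le (by simp) (by simp)]; norm_num
          · rw [div_le_one hp0]; exact hp
      _ = _ := by rw [ENNReal.rpow_one]
  have h5 : ∑' k : ℕ, (1 / 2 : ℝ≥0∞) ^ k * a k ^ (1 / p) ≤ 3 * M ^ (1 / p) := by
    calc ∑' k : ℕ, (1 / 2 : ℝ≥0∞) ^ k * a k ^ (1 / p)
        ≤ ∑' k : ℕ, (2 / 3 : ℝ≥0∞) ^ k * M ^ (1 / p) := by
          apply ENNReal.tsum_le_tsum; intro k
          calc (1 / 2 : ℝ≥0∞) ^ k * a k ^ (1 / p)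
              ≤ (1 / 2 : ℝ≥0∞) ^ k * ((4 / 3 : ℝ≥0∞) ^ k * M ^ (1 / p)) := by
                gcongr; exact h4 k
            _ = _ := by
              rw [← mul_assoc, ← mul_pow]
              congr 2
              have e1 : (1 / 2 : ℝ≥0∞) = ENNReal.ofReal (1 / 2) := by
                rw [ENNReal.ofReal_div_of_pos (by norm_num)]; norm_num
              have e2 : (4 / 3 : ℝ≥0∞) = ENNReal.ofReal (4 / 3) := by
                rw [ENNReal.ofReal_div_of_pos (by norm_num)]; norm_num
              have e3 : (2 / 3 : ℝ≥0∞) = ENNReal.ofReal (2 / 3) := by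
                rw [ENNReal.ofReal_div_of_pos (by norm_num)]; norm_num
              rw [e1, e2, e3, ← ENNReal.ofReal_mul (by norm_num)]
              norm_num
      _ = 3 * M ^ (1 / p) := by
          rw [ENNReal.tsum_mul_right, ENNReal.tsum_geometric]
          congr 1
          have e3 : (2 / 3 : ℝ≥0∞) = ENNReal.ofReal (2 / 3) := by
            rw [ENNReal.ofReal_div_of_pos (by norm_num)]; norm_num
          rw [e3, ← ENNReal.ofReal_one, ← ENNReal.ofReal_sub _ (by norm_num),
            ← ENNReal.ofReal_inv_of_pos (by norm_num)]
          norm_num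
  calc _ ≤ (3 * M ^ (1 / p)) ^ p := ENNReal.rpow_le_rpow h5 hp0.le
    _ = _ := by
      rw [ENNReal.mul_rpow_of_nonneg _ _ hp0.le, ← ENNReal.rpow_mul, one_div,
        inv_mul_cancel₀ hp0.ne', ENNReal.rpow_one]


/-! ### Geometry -/

lemma mem_setBall_of_dist_le {S : Set X} {x y : X} {a b : ℝ} (ha : 0 ≤ a) (hb : 0 ≤ b)
    (hx : x ∈ setBall S a) (hxy : dist y x ≤ b) : y ∈ setBall S (a + b) := by
  change Metric.infEDist y S ≤ ENNReal.ofReal (a + b)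
  have hx' : Metric.infEDist x S ≤ ENNReal.ofReal a := hx
  calc Metric.infEDist y S ≤ Metric.infEDist x S + edist y x := infEDist_le_infEDist_add_edist
    _ ≤ ENNReal.ofReal a + ENNReal.ofReal b := by
        gcongr
        rw [edist_dist]; exact ENNReal.ofReal_le_ofReal hxy
    _ = _ := (ENNReal.ofReal_add ha hb).symm

lemma setBall_mono {S : Set X} {a b : ℝ} (h : a ≤ b) : setBall S a ⊆ setBall S b := by
  intro x hx
  exact le_trans hx (ENNReal.ofReal_le_ofReal h)

lemma subset_setBall {S : Set X} {a : ℝ} : S ⊆ setBall S a := by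
  intro x hx
  change Metric.infEDist x S ≤ ENNReal.ofReal a
  rw [Metric.infEDist_zero_of_mem hx]; exact zero_le

lemma mem_image_of_setBall {S S₀ : Set X} {R : ℝ} (hR : 0 ≤ R)
    (h : ENNReal.ofReal (R + R) < compDist S S₀) {x : X} (hx : x ∈ setBall S R)
    {z : UniformSpace.Completion X}
    (hz : edist (x : UniformSpace.Completion X) z ≤ ENNReal.ofReal R) :
    z ∈ (fun a : X => (a : UniformSpace.Completion X)) '' S₀ := by
  by_contra hcon
  have h1 : ∀ a ∈ S, compDist S S₀ - ENNReal.ofReal R ≤ edist x a := by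
    intro a ha
    rw [tsub_le_iff_right]
    have h2 : compDist S S₀ ≤ edist (a : UniformSpace.Completion X) z := by
      unfold compDist
      exact iInf_le_of_le a (iInf_le_of_le ha (iInf_le_of_le z (iInf_le _ hcon)))
    calc compDist S S₀ ≤ edist (a : UniformSpace.Completion X) z := h2
      _ ≤ edist (a : UniformSpace.Completion X) x + edist (x : UniformSpace.Completion X) z :=
          edist_triangle _ _ _
      _ ≤ edist x a + ENNReal.ofReal R := by
          rw [UniformSpace.Completion.edist_eq, edist_comm]; gcongr
  have h3 : compDist S S₀ - ENNReal.ofReal R ≤ Metric.infEDist x S := Metric.le_infEDist.2 h1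
  have h4 : Metric.infEDist x S ≤ ENNReal.ofReal R := hx
  have h5 := h3.trans h4
  rw [tsub_le_iff_right, ← ENNReal.ofReal_add hR hR] at h5
  exact absurd h (not_lt.2 h5)

lemma isComplete_closedBall_of_image {x : X} {s : ℝ} (hs : 0 ≤ s)
    (h : ∀ z : UniformSpace.Completion X, edist (x : UniformSpace.Completion X) z ≤
      ENNReal.ofReal s → ∃ a : X, (a : UniformSpace.Completion X) = z) :
    IsComplete (closedBall x s) := by
  have hu : IsUniformInducing (fun a : X => (a : UniformSpace.Completion X)) :=
    UniformSpace.Completion.isUniformInducing_coe X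
  rw [← isComplete_image_iff hu]
  have himg : (fun a : X => (a : UniformSpace.Completion X)) '' closedBall x s =
      {z | edist (x : UniformSpace.Completion X) z ≤ ENNReal.ofReal s} := by
    ext z
    constructor
    · rintro ⟨a, ha, rfl⟩
      change edist (x : UniformSpace.Completion X) a ≤ ENNReal.ofReal s
      rw [UniformSpace.Completion.edist_eq, edist_dist, dist_comm]
      exact ENNReal.ofReal_le_ofReal (mem_closedBall.1 ha)
    · intro hz
      obtain ⟨a, rfl⟩ := h z hz
      refine ⟨a, ?_, rfl⟩
      have hz' : edist (x : UniformSpace.Completion X) a ≤ ENNReal.ofReal s := hz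
      rw [UniformSpace.Completion.edist_eq, edist_dist, dist_comm] at hz'
      exact (ENNReal.ofReal_le_ofReal_iff hs).1 hz'
  rw [himg]
  apply IsClosed.isComplete
  exact isClosed_le (by fun_prop) continuous_const

lemma wellInside_singleton (hloc : ∀ x : X, ∃ r > 0, IsComplete (closedBall x r)) (x : X) :
    WellInside {x} (univ : Set X) := by
  refine ⟨subset_univ _, ?_⟩
  obtain ⟨r, hr, hc⟩ := hloc x
  have hu : IsUniformInducing (fun a : X => (a : UniformSpace.Completion X)) :=
    UniformSpace.Completion.isUniformInducing_coe X
  have hcl : IsClosed ((fun a : X => (a : UniformSpace.Completion X)) '' closedBall x r) :=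
    ((isComplete_image_iff hu).2 hc).isClosed
  refine lt_of_lt_of_le (ENNReal.ofReal_pos.2 hr) ?_
  unfold compDist
  refine le_iInf fun x' => le_iInf fun hx' => le_iInf fun z => le_iInf fun hz => ?_
  rw [mem_singleton_iff] at hx'
  subst hx'
  by_contra hcon
  push Not at hcon
  apply hz
  have hz1 : z ∈ closure ((fun a : X => (a : UniformSpace.Completion X)) '' closedBall x' r) := by
    have hd : z ∈ closure (range (fun a : X => (a : UniformSpace.Completion X))) :=
      UniformSpace.Completion.denseRange_coe z
    rw [_root_.mem_closure_iff] at hd ⊢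
    intro o ho hzo
    have hopen : IsOpen {w : UniformSpace.Completion X |
        edist (x' : UniformSpace.Completion X) w < ENNReal.ofReal r} :=
      isOpen_lt (by fun_prop) continuous_const
    obtain ⟨w, hw1, ⟨a, rfl⟩⟩ := hd _ (ho.inter hopen) ⟨hzo, hcon⟩
    refine ⟨_, hw1.1, a, ?_, rfl⟩
    have h2 : edist (x' : UniformSpace.Completion X) a < ENNReal.ofReal r := hw1.2
    rw [UniformSpace.Completion.edist_eq, edist_dist, dist_comm] at h2
    exact (ENNReal.ofReal_le_ofReal_iff hr.le).1 h2.le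
  rw [hcl.closure_eq] at hz1
  exact image_mono (subset_univ _) hz1

lemma doubling_iterate {m : Measure X} {C : ℝ≥0∞} {y : X} {R : ℝ} (hR : 0 < R)
    (h : ∀ r, 0 < r → r ≤ R → m (closedBall y (2 * r)) ≤ C * m (closedBall y r)) (k : ℕ) :
    m (closedBall y R) ≤ C ^ k * m (closedBall y (R / 2 ^ k)) := by
  induction k with
  | zero => simp
  | succ k ih =>
    have hpos : (0 : ℝ) < 2 ^ (k + 1) := by positivity
    have h1 : 2 * (R / 2 ^ (k + 1)) = R / 2 ^ k := by
      rw [pow_succ]; field_simp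
    have h2 := h (R / 2 ^ (k + 1)) (by positivity)
      (div_le_self hR.le (one_le_pow₀ (by norm_num)))
    rw [h1] at h2
    calc m (closedBall y R) ≤ C ^ k * m (closedBall y (R / 2 ^ k)) := ih
      _ ≤ C ^ k * (C * m (closedBall y (R / 2 ^ (k + 1)))) := by gcongr
      _ = _ := by rw [pow_succ C k, mul_assoc]

lemma totallyBounded_of_doubling [BorelSpace X] {m : Measure X} {C : ℝ≥0∞} (hC : C ≠ ⊤) {x : X}
    {R s : ℝ} (hR : 0 < R) (hs : s ≤ R / 2)
    (h : ∀ y ∈ closedBall x s, ∀ r, 0 < r → r ≤ R →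
      m (closedBall y (2 * r)) ≤ C * m (closedBall y r))
    (hpos : 0 < m (closedBall x (R / 2))) (hfin : m (closedBall x R) < ⊤) :
    TotallyBounded (closedBall x s) := by
  rw [Metric.totallyBounded_iff]
  intro ε hε
  by_contra hcon
  push Not at hcon
  obtain ⟨y, hy1, hy2⟩ := exists_seq_of_forall_finset_exists (fun y => y ∈ closedBall x s)
    (fun a b => ε ≤ dist a b) (by
      intro F hF
      have h1 := hcon (F : Set X) F.finite_toSet
      rw [not_subset] at h1
      obtain ⟨b, hb, hb2⟩ := h1
      refine ⟨b, hb, fun a ha => ?_⟩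
      by_contra hlt
      push Not at hlt
      apply hb2
      simp only [mem_iUnion]
      exact ⟨a, ha, by rw [mem_ball, dist_comm]; exact hlt⟩)
  obtain ⟨k, hk⟩ : ∃ k : ℕ, R / 2 ^ k < ε / 2 ∧ R / 2 ^ k ≤ R / 2 := by
    obtain ⟨k, hk⟩ := pow_unbounded_of_one_lt (2 * R / ε) (by norm_num : (1 : ℝ) < 2)
    refine ⟨k + 1, ?_, ?_⟩
    · rw [div_lt_iff₀ hε] at hk
      rw [div_lt_iff₀ (by positivity), pow_succ]
      nlinarith
    · apply div_le_div_of_nonneg_left hR.le (by norm_num)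
      rw [pow_succ]
      have : (1 : ℝ) ≤ 2 ^ k := one_le_pow₀ (by norm_num)
      linarith
  set A : ℕ → Set X := fun n => closedBall (y n) (R / 2 ^ k) with hA
  have hdisj : Pairwise (Function.onFun Disjoint A) := by
    intro i j hij
    apply closedBall_disjoint_closedBall
    have hd : ε ≤ dist (y i) (y j) := by
      rcases lt_or_gt_of_ne hij with h | h
      · exact hy2 _ _ h
      · rw [dist_comm]; exact hy2 _ _ h
    linarith [hk.1]
  have hun : m (⋃ n, A n) ≠ ⊤ := by
    refine ne_top_of_le_ne_top hfin.ne (measure_mono ?_)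
    apply iUnion_subset
    intro n
    apply closedBall_subset_closedBall'
    have := mem_closedBall.1 (hy1 n)
    linarith [hk.2]
  set c : ℝ≥0∞ := m (closedBall x (R / 2)) / C ^ k with hc
  have hcpos : 0 < c := ENNReal.div_pos hpos.ne' (ENNReal.pow_ne_top hC)
  have hfin2 := Measure.finite_const_le_meas_of_disjoint_iUnion m hcpos
    (fun n => (measurableSet_closedBall : MeasurableSet (A n))) hdisj hun
  have hall : {i : ℕ | c ≤ m (A i)} = univ := by
    rw [eq_univ_iff_forall]
    intro n
    change c ≤ m (A n)
    rw [hc]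
    apply ENNReal.div_le_of_le_mul'
    refine le_trans (measure_mono ?_) (doubling_iterate hR (h (y n) (hy1 n)) k)
    apply closedBall_subset_closedBall'
    have := mem_closedBall.1 (hy1 n)
    rw [dist_comm] at this
    linarith
  rw [hall] at hfin2
  exact infinite_univ hfin2

lemma wellInside_univ {S S₀ : Set X} (h : WellInside S S₀) : WellInside S univ := by
  refine ⟨subset_univ _, lt_of_lt_of_le h.2 ?_⟩
  unfold compDist
  refine iInf_mono fun x => iInf_mono fun hx => iInf_mono fun z => ?_
  refine le_iInf fun hz => iInf_le_of_le ?_ le_rfl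
  intro hz'
  exact hz (image_mono (subset_univ _) hz')

lemma doublingOn_mono {m : Measure X} {C_D : ℝ≥0} {S : Set X} {R R' : ℝ} (hRR : R' ≤ R)
    (h : DoublingOn m C_D S R) : DoublingOn m C_D S R' :=
  fun x hx r h0 hr => h x (setBall_mono hRR hx) r h0 (hr.trans hRR)

lemma poincareOn_mono {m : Measure X} {p C_P lam : ℝ} (hlam : 0 ≤ lam) {S : Set X} {R R' : ℝ}
    (hRR : R' ≤ R) (h : PoincareOn m p C_P lam S R) : PoincareOn m p C_P lam S R' :=
  ⟨fun x hx r h0 hr => h.1 x (setBall_mono hRR hx) r h0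
      (hr.trans (mul_le_mul_of_nonneg_left hRR hlam)),
    fun u hu x hx r h0 hr => h.2 u hu x (setBall_mono hRR hx) r h0 (hr.trans hRR)⟩

/-- Uniform constants on a well contained set. -/
lemma exists_good_radius [BorelSpace X] {m : Measure X} {p : ℝ} {C_D : ℝ≥0}
    (hD : InternallyDoubling m C_D)
    {C_P lam : ℝ} (hP : InternalPoincare m p C_P lam) {Ω Ω' : Set X} (h : WellInside Ω' Ω) :
    ∃ R > 0, DoublingOn m C_D Ω' R ∧ PoincareOn m p C_P lam Ω' R ∧
      ∀ x ∈ setBall Ω' R, ∀ s, 0 ≤ s → s ≤ R →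
        IsCompact (closedBall x s) ∧ closedBall x s ⊆ Ω := by
  obtain ⟨R1, hR1, hD1⟩ := hD.2 Ω' (wellInside_univ h)
  obtain ⟨R2, hR2, hP2⟩ := hP.2.2 Ω' (wellInside_univ h)
  obtain ⟨R3, hR3, hR3'⟩ : ∃ R3 > 0, ENNReal.ofReal (R3 + R3) < compDist Ω' Ω := by
    obtain ⟨q, hq0, hq⟩ := ENNReal.lt_iff_exists_real_btwn.1 h.2
    refine ⟨q / 2, ?_, ?_⟩
    · have := ENNReal.ofReal_pos.1 hq.1
      positivity
    · rw [add_halves]; exact hq.2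
  set R0 := min R1 (min R2 R3) with hR0
  have hR0pos : 0 < R0 := lt_min hR1 (lt_min hR2 hR3)
  have h01 : R0 ≤ R1 := min_le_left _ _
  have h02 : R0 ≤ R2 := (min_le_right _ _).trans (min_le_left _ _)
  have h03 : R0 ≤ R3 := (min_le_right _ _).trans (min_le_right _ _)
  have hlam : 0 ≤ lam := le_trans zero_le_one hP.2.1
  have hDm := doublingOn_mono h01 hD1
  refine ⟨R0 / 4, by positivity, doublingOn_mono (by linarith) hDm,
    poincareOn_mono hlam (by linarith) hP2, ?_⟩
  intro x hx s hs0 hs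
  have hx0 : x ∈ setBall Ω' R3 := setBall_mono (by linarith) hx
  have hx1 : x ∈ setBall Ω' R0 := setBall_mono (by linarith) hx
  have key : ∀ z : UniformSpace.Completion X, edist (x : UniformSpace.Completion X) z ≤
      ENNReal.ofReal s → z ∈ (fun a : X => (a : UniformSpace.Completion X)) '' Ω := by
    intro z hz
    exact mem_image_of_setBall hR3.le hR3' hx0
      (hz.trans (ENNReal.ofReal_le_ofReal (by linarith)))
  constructor
  · rw [isCompact_iff_totallyBounded_isComplete]
    constructor
    · apply totallyBounded_of_doubling (m := m) (C := (C_D : ℝ≥0∞)) ENNReal.coe_ne_top hR0pos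
        (by linarith)
      · intro y hy r hr0 hr
        have hy' : y ∈ setBall Ω' (R0 / 4 + s) :=
          mem_setBall_of_dist_le (by positivity) hs0 hx (mem_closedBall.1 hy)
        exact (hDm y (setBall_mono (by linarith) hy') r hr0 hr).2.1
      · have := (hDm x hx1 (R0 / 4) (by positivity) (by linarith)).1
        have h4 : 2 * (R0 / 4) = R0 / 2 := by ring
        rwa [h4] at this
      · exact (hDm x hx1 R0 hR0pos le_rfl).2.2
    · apply isComplete_closedBall_of_image hs0
      intro z hz
      obtain ⟨a, _, ha⟩ := key z hz
      exact ⟨a, ha⟩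
  · intro y hy
    obtain ⟨a, ha, hay⟩ := key (y : UniformSpace.Completion X) (by
      rw [UniformSpace.Completion.edist_eq, edist_dist, dist_comm]
      exact ENNReal.ofReal_le_ofReal (mem_closedBall.1 hy))
    have : a = y := UniformSpace.Completion.coe_injective X hay
    rwa [← this]


/-! ### Poincaré inequality for functions of finite energy -/

lemma lipAt_congr {O : Set X} (hO : IsOpen O) {v w : X → ℝ} {x : X} (hx : x ∈ O)
    (h : v =ᶠ[𝓝 x] w) : lipAt univ w x = lipAt O v x := by
  unfold lipAt
  have h1 : 𝓝[O \ {x}] x = 𝓝[univ \ {x}] x := by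
    rw [diff_eq, diff_eq, univ_inter, inter_comm]
    apply nhdsWithin_inter_of_mem'
    exact mem_nhdsWithin_of_mem_nhds (hO.mem_nhds hx)
  rw [h1]
  apply limsup_congr
  have h2 : v =ᶠ[𝓝[univ \ {x}] x] w := h.filter_mono nhdsWithin_le_nhds
  filter_upwards [h2] with y hy
  rw [hy, h.eq_of_nhds]

lemma exists_lipschitz_ext {O K : Set X} {v : X → ℝ} (hv : LocLipschitzOn O v)
    (hK : IsCompact K) (hKO : K ⊆ O) :
    ∃ w : X → ℝ, (∃ L : ℝ≥0, LipschitzWith L w) ∧ EqOn v w K := by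
  have h1 : LocallyLipschitzOn K v := by
    intro x hx
    obtain ⟨r, hr, L, _, hL⟩ := hv x (hKO hx)
    exact ⟨L, closedBall x r, mem_nhdsWithin_of_mem_nhds (closedBall_mem_nhds x hr), hL⟩
  obtain ⟨L, hL⟩ := h1.exists_lipschitzOnWith_of_compact hK
  obtain ⟨w, hw1, hw2⟩ := hL.extend_real
  exact ⟨w, ⟨L, hw1⟩, hw2⟩

lemma dd_le {m : Measure X} {B : Set X} {F b : X → X → ℝ≥0∞} {a : X → ℝ≥0∞}
    (ha : Measurable a) (h : ∀ y z, F y z ≤ a y + a z + b y z) :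
    ∫⁻ y in B, ∫⁻ z in B, F y z ∂m ∂m ≤
      2 * m B * ∫⁻ y in B, a y ∂m + ∫⁻ y in B, ∫⁻ z in B, b y z ∂m ∂m := by
  have h1 : ∀ y, ∫⁻ z in B, F y z ∂m ≤
      (a y * m B + ∫⁻ z in B, a z ∂m) + ∫⁻ z in B, b y z ∂m := by
    intro y
    calc ∫⁻ z in B, F y z ∂m ≤ ∫⁻ z in B, ((a y + a z) + b y z) ∂m :=
          lintegral_mono fun z => h y z
      _ = ∫⁻ z in B, (a y + a z) ∂m + ∫⁻ z in B, b y z ∂m :=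
          lintegral_add_left (by fun_prop) _
      _ = _ := by rw [lintegral_add_left (by fun_prop), setLIntegral_const]
  calc ∫⁻ y in B, ∫⁻ z in B, F y z ∂m ∂m
      ≤ ∫⁻ y in B, ((a y * m B + ∫⁻ z in B, a z ∂m) + ∫⁻ z in B, b y z ∂m) ∂m :=
        lintegral_mono h1
    _ = ∫⁻ y in B, (a y * m B + ∫⁻ z in B, a z ∂m) ∂m +
          ∫⁻ y in B, ∫⁻ z in B, b y z ∂m ∂m := lintegral_add_left (by fun_prop) _
    _ = _ := by
      rw [lintegral_add_left (by fun_prop), setLIntegral_const, lintegral_mul_const _ ha]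
      ring

lemma ofReal_abs_triangle (a b c : ℝ) :
    ENNReal.ofReal |a - c| ≤ ENNReal.ofReal |a - b| + ENNReal.ofReal |b - c| := by
  rw [← ENNReal.ofReal_add (abs_nonneg _) (abs_nonneg _)]
  exact ENNReal.ofReal_le_ofReal (abs_sub_le a b c)

lemma tendsto_lp_compact {m : Measure X} {p : ℝ} {O K : Set X} {v : ℕ → X → ℝ} {u : X → ℝ}
    (hO : IsOpen O)
    (h : TendstoLpLoc m p O v u) (hK : IsCompact K) (hKO : K ⊆ O) :
    Tendsto (fun n => ∫⁻ x in K, ENNReal.ofReal |v n x - u x| ^ p ∂m) atTop (𝓝 0) := by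
  refine hK.induction_on
    (p := fun S => Tendsto (fun n => ∫⁻ x in S, ENNReal.ofReal |v n x - u x| ^ p ∂m) atTop (𝓝 0))
    ?_ ?_ ?_ ?_
  · simp
  · intro s t hst ht
    exact tendsto_of_tendsto_of_tendsto_of_le_of_le tendsto_const_nhds ht (fun _ => zero_le)
      (fun n => lintegral_mono_set hst)
  · intro s t hs ht
    have := hs.add ht
    rw [add_zero] at this
    exact tendsto_of_tendsto_of_tendsto_of_le_of_le tendsto_const_nhds this (fun _ => zero_le)
      (fun n => lintegral_union_le _ _ _)
  · intro x hx
    obtain ⟨r, hr, h1⟩ := h x (hKO hx)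
    exact ⟨_, mem_nhdsWithin_of_mem_nhds
      (inter_mem (hO.mem_nhds (hKO hx)) (closedBall_mem_nhds x hr)), h1⟩

lemma lintegral_le_lp {m : Measure X} {p : ℝ} (hp : 1 ≤ p) {B : Set X} {g : X → ℝ}
    (hg : Measurable g) :
    ∫⁻ x in B, ENNReal.ofReal |g x| ∂m ≤
      (∫⁻ x in B, ENNReal.ofReal |g x| ^ p ∂m) ^ (1 / p) * m B ^ (1 - 1 / p) := by
  have := eLpNorm'_le_eLpNorm'_mul_rpow_measure_univ (μ := m.restrict B) (f := g)
    zero_lt_one hp hg.aestronglyMeasurable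
  simpa [eLpNorm', Real.enorm_eq_ofReal_abs] using this

lemma poincare_energy [BorelSpace X] {m : Measure X}
    {p C_P lam : ℝ} (hp : 1 ≤ p) (hlam : 1 ≤ lam) {Ω : Set X} {u : X → ℝ} (hu : Measurable u)
    {x : X} {s : ℝ} (hs : 0 < s) (hK : IsCompact (closedBall x (2 * lam * s)))
    (hB0 : 0 < m (closedBall x s)) (hB : m (closedBall x s) < ⊤)
    (hBl : 0 < m (closedBall x (lam * s)))
    (hP : ∀ w : X → ℝ, (∃ L : ℝ≥0, LipschitzWith L w) →
      (m (closedBall x s))⁻¹ *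
          ∫⁻ x' in closedBall x s,
            ENNReal.ofReal |w x' - ⨍ x'' in closedBall x s, w x'' ∂m| ∂m ≤
        ENNReal.ofReal (C_P * s) *
          ((m (closedBall x (lam * s)))⁻¹ *
              ∫⁻ x' in closedBall x (lam * s), lipAt univ w x' ^ p ∂m) ^ (1 / p))
    {N : ℝ≥0∞} (hNt : N < ⊤) (hN : cheegerSet m p Ω u (closedBall x (2 * lam * s)) ≤ N) :
    ∫⁻ y in closedBall x s, ∫⁻ z in closedBall x s, ENNReal.ofReal |u y - u z| ∂m ∂m ≤
      2 * m (closedBall x s) * (m (closedBall x s) * (ENNReal.ofReal (C_P * s) *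
        ((m (closedBall x (lam * s)))⁻¹ * N) ^ (1 / p))) := by
  set B := closedBall x s with hBdef
  set K := closedBall x (2 * lam * s) with hKdef
  have hp0 : 0 < p := by linarith
  have hBK : B ⊆ K := closedBall_subset_closedBall (by nlinarith)
  have hlK : closedBall x (lam * s) ⊆ ball x (2 * lam * s) :=
    closedBall_subset_ball (by nlinarith)
  set G : ℝ≥0∞ → ℝ≥0∞ := fun N => 2 * m B * (m B * (ENNReal.ofReal (C_P * s) *
        ((m (closedBall x (lam * s)))⁻¹ * N) ^ (1 / p))) with hG
  have hGc : Continuous G := by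
    apply ENNReal.continuous_const_mul (ENNReal.mul_ne_top (by simp) hB.ne) |>.comp
    apply ENNReal.continuous_const_mul hB.ne |>.comp
    apply ENNReal.continuous_const_mul ENNReal.ofReal_ne_top |>.comp
    apply ENNReal.continuous_rpow_const.comp
    exact ENNReal.continuous_const_mul (ENNReal.inv_ne_top.2 hBl.ne')
  suffices hmain : ∀ N' > N, ∫⁻ y in B, ∫⁻ z in B, ENNReal.ofReal |u y - u z| ∂m ∂m ≤ G N' by
    have ht : Tendsto (fun N' => G N') (𝓝[>] N) (𝓝 (G N)) :=
      (hGc.tendsto N).mono_left nhdsWithin_le_nhds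
    have : (𝓝[>] N).NeBot := nhdsGT_neBot_of_exists_gt ⟨⊤, hNt⟩
    refine ge_of_tendsto ht ?_
    filter_upwards [self_mem_nhdsWithin] with N' hN'
    exact hmain N' hN'
  intro N' hN'
  have h1 : cheegerSet m p Ω u K < N' := lt_of_le_of_lt hN hN'
  unfold cheegerSet at h1
  simp only [iInf_lt_iff] at h1
  obtain ⟨O, hO, hOΩ, hKO, h2⟩ := h1
  unfold cheegerOpen at h2
  simp only [iInf_lt_iff] at h2
  obtain ⟨v, hv, hvu, h3⟩ := h2
  have h4 := frequently_lt_of_liminf_lt (by isBoundedDefault) h3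
  choose w hwL hwE using fun n => exists_lipschitz_ext (hv n) hK hKO
  have hwm : ∀ n, Measurable (w n) := fun n => by
    obtain ⟨L, hL⟩ := hwL n
    exact hL.continuous.measurable
  -- convergence on the ball
  have h5 : Tendsto (fun n => ∫⁻ y in B, ENNReal.ofReal |w n y - u y| ∂m) atTop (𝓝 0) := by
    have h6 := tendsto_lp_compact hO hvu hK hKO
    have h7 : Tendsto (fun n => (∫⁻ y in B, ENNReal.ofReal |w n y - u y| ^ p ∂m) ^ (1 / p) *
        m B ^ (1 - 1 / p)) atTop (𝓝 0) := by
      have h8 : Tendsto (fun n => ∫⁻ y in B, ENNReal.ofReal |w n y - u y| ^ p ∂m) atTop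
          (𝓝 0) := by
        refine tendsto_of_tendsto_of_tendsto_of_le_of_le tendsto_const_nhds h6
          (fun _ => zero_le) (fun n => ?_)
        calc ∫⁻ y in B, ENNReal.ofReal |w n y - u y| ^ p ∂m
            = ∫⁻ y in B, ENNReal.ofReal |v n y - u y| ^ p ∂m := by
              apply setLIntegral_congr_fun measurableSet_closedBall
              intro y hy
              simp only
              rw [hwE n (hBK hy)]
          _ ≤ _ := lintegral_mono_set hBK
      have h9 := (ENNReal.continuous_rpow_const (y := 1 / p)).tendsto 0 |>.comp h8
      rw [ENNReal.zero_rpow_of_pos (by positivity)] at h9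
      have h10 := ENNReal.Tendsto.mul_const (b := m B ^ (1 - 1 / p)) h9 (Or.inr (by
        apply ENNReal.rpow_ne_top_of_nonneg _ hB.ne
        rw [sub_nonneg, div_le_one hp0]; exact hp))
      rw [zero_mul] at h10
      exact h10
    exact tendsto_of_tendsto_of_tendsto_of_le_of_le tendsto_const_nhds h7 (fun _ => zero_le)
      (fun n => lintegral_le_lp hp ((hwm n).sub hu))
  have h11 : Tendsto (fun n => 2 * m B * ∫⁻ y in B, ENNReal.ofReal |w n y - u y| ∂m + G N')
      atTop (𝓝 (2 * m B * 0 + G N')) :=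
    (ENNReal.Tendsto.const_mul h5 (Or.inr (ENNReal.mul_ne_top (by simp) hB.ne))).add
      tendsto_const_nhds
  rw [mul_zero, zero_add] at h11
  refine ge_of_tendsto_of_frequently h11 (h4.mono ?_)
  intro n hn
  have h12 : ∫⁻ y in B, ∫⁻ z in B, ENNReal.ofReal |u y - u z| ∂m ∂m ≤
      2 * m B * ∫⁻ y in B, ENNReal.ofReal |w n y - u y| ∂m +
        ∫⁻ y in B, ∫⁻ z in B, ENNReal.ofReal |w n y - w n z| ∂m ∂m := by
    apply dd_le
    · have := hwm n
      fun_prop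
    · intro y z
      calc ENNReal.ofReal |u y - u z| ≤
          ENNReal.ofReal |u y - w n y| + ENNReal.ofReal |w n y - u z| :=
            ofReal_abs_triangle _ _ _
        _ ≤ ENNReal.ofReal |u y - w n y| + (ENNReal.ofReal |w n y - w n z| +
              ENNReal.ofReal |w n z - u z|) := by gcongr; exact ofReal_abs_triangle _ _ _
        _ = _ := by rw [abs_sub_comm (u y)]; ring
  refine h12.trans ?_
  gcongr
  set c := ⨍ x'' in B, w n x'' ∂m with hc
  have h13 : ∫⁻ y in B, ∫⁻ z in B, ENNReal.ofReal |w n y - w n z| ∂m ∂m ≤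
      2 * m B * ∫⁻ y in B, ENNReal.ofReal |w n y - c| ∂m +
        ∫⁻ y in B, ∫⁻ z in B, 0 ∂m ∂m := by
    apply dd_le
    · have := hwm n
      fun_prop
    · intro y z
      rw [add_zero, abs_sub_comm (w n z)]
      exact ofReal_abs_triangle _ _ _
  simp only [lintegral_zero, add_zero] at h13
  refine h13.trans ?_
  simp only [hG]
  gcongr 2 * m B * ?_
  have h14 := hP (w n) (hwL n)
  calc ∫⁻ y in B, ENNReal.ofReal |w n y - c| ∂m
      = m B * ((m B)⁻¹ * ∫⁻ y in B, ENNReal.ofReal |w n y - c| ∂m) := by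
        rw [← mul_assoc, ENNReal.mul_inv_cancel hB0.ne' hB.ne, one_mul]
    _ ≤ m B * (ENNReal.ofReal (C_P * s) *
          ((m (closedBall x (lam * s)))⁻¹ *
              ∫⁻ x' in closedBall x (lam * s), lipAt univ (w n) x' ^ p ∂m) ^ (1 / p)) := by
        gcongr
    _ ≤ _ := by
        gcongr
        calc ∫⁻ x' in closedBall x (lam * s), lipAt univ (w n) x' ^ p ∂m
            = ∫⁻ x' in closedBall x (lam * s), lipAt O (v n) x' ^ p ∂m := by
              apply setLIntegral_congr_fun measurableSet_closedBall
              intro y hy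
              simp only
              have hyb := hlK hy
              rw [lipAt_congr hO (hKO (ball_subset_closedBall hyb))]
              filter_upwards [isOpen_ball.mem_nhds hyb] with z hz
              exact hwE n (ball_subset_closedBall hz)
          _ ≤ ∫⁻ x' in O, lipAt O (v n) x' ^ p ∂m :=
              lintegral_mono_set ((hlK.trans ball_subset_closedBall).trans hKO)
          _ ≤ N' := hn.le


/-! ### Telescoping -/

/-- Mean oscillation of `u` at the point `x`. -/
def LL (m : Measure X) (u : X → ℝ) (x : X) (s : ℝ) : ℝ≥0∞ :=
  (m (closedBall x s))⁻¹ * ∫⁻ y in closedBall x s, ENNReal.ofReal |u x - u y| ∂m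

lemma LL_step [BorelSpace X] {m : Measure X} {u : X → ℝ} (hu : Measurable u) {x : X} {s : ℝ}
    (hs : 0 < s)
    {C P : ℝ≥0∞} (hC0 : C ≠ 0) (hC : C ≠ ⊤) (h0 : 0 < m (closedBall x (s / 2)))
    (hfin : m (closedBall x s) < ⊤)
    (hd : m (closedBall x s) ≤ C * m (closedBall x (s / 2)))
    (hDD : ∫⁻ y in closedBall x s, ∫⁻ z in closedBall x s, ENNReal.ofReal |u y - u z| ∂m ∂m ≤
      2 * m (closedBall x s) * (m (closedBall x s) * P)) :
    LL m u x s ≤ LL m u x (s / 2) + C * (2 * P) := by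
  have hsub : closedBall x (s / 2) ⊆ closedBall x s := closedBall_subset_closedBall (by linarith)
  set b := closedBall x (s / 2) with hb
  set B := closedBall x s with hB
  have hb' : m b ≠ ⊤ := ((measure_mono hsub).trans_lt hfin).ne
  have hB0 : m B ≠ 0 := (h0.trans_le (measure_mono hsub)).ne'
  have h1 : m b * ∫⁻ y in B, ENNReal.ofReal |u x - u y| ∂m ≤
      m B * ∫⁻ z in b, ENNReal.ofReal |u x - u z| ∂m + 2 * m B * (m B * P) := by
    calc m b * ∫⁻ y in B, ENNReal.ofReal |u x - u y| ∂m
        = ∫⁻ z in b, ∫⁻ y in B, ENNReal.ofReal |u x - u y| ∂m ∂m := by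
          rw [setLIntegral_const, mul_comm]
      _ ≤ ∫⁻ z in b, (ENNReal.ofReal |u x - u z| * m B +
            ∫⁻ y in B, ENNReal.ofReal |u z - u y| ∂m) ∂m := by
          apply lintegral_mono
          intro z
          calc ∫⁻ y in B, ENNReal.ofReal |u x - u y| ∂m
              ≤ ∫⁻ y in B, (ENNReal.ofReal |u x - u z| + ENNReal.ofReal |u z - u y|) ∂m :=
                lintegral_mono fun y => ofReal_abs_triangle _ _ _
            _ = _ := by rw [lintegral_add_left (by fun_prop), setLIntegral_const]
      _ = m B * ∫⁻ z in b, ENNReal.ofReal |u x - u z| ∂m +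
            ∫⁻ z in b, ∫⁻ y in B, ENNReal.ofReal |u z - u y| ∂m ∂m := by
          rw [lintegral_add_left (by fun_prop), lintegral_mul_const _ (by fun_prop), mul_comm]
      _ ≤ _ := by
          gcongr
          exact (lintegral_mono_set hsub).trans hDD
  have h2 : (m b)⁻¹ ≤ C * (m B)⁻¹ := ennreal_inv_le_of_le_mul hC0 hC hd
  unfold LL
  calc (m B)⁻¹ * ∫⁻ y in B, ENNReal.ofReal |u x - u y| ∂m
      = (m B)⁻¹ * (m b)⁻¹ * (m b * ∫⁻ y in B, ENNReal.ofReal |u x - u y| ∂m) := by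
        rw [mul_assoc, ← mul_assoc (m b)⁻¹, ENNReal.inv_mul_cancel h0.ne' hb', one_mul]
    _ ≤ (m B)⁻¹ * (m b)⁻¹ *
          (m B * ∫⁻ z in b, ENNReal.ofReal |u x - u z| ∂m + 2 * m B * (m B * P)) := by gcongr
    _ = (m B)⁻¹ * m B * ((m b)⁻¹ * ∫⁻ z in b, ENNReal.ofReal |u x - u z| ∂m) +
          (m B)⁻¹ * m B * ((m b)⁻¹ * m B * (2 * P)) := by ring
    _ = (m b)⁻¹ * ∫⁻ z in b, ENNReal.ofReal |u x - u z| ∂m + (m b)⁻¹ * m B * (2 * P) := by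
        rw [ENNReal.inv_mul_cancel hB0 hfin.ne, one_mul, one_mul]
    _ ≤ (m b)⁻¹ * ∫⁻ z in b, ENNReal.ofReal |u x - u z| ∂m +
          C * (m B)⁻¹ * m B * (2 * P) := by gcongr
    _ = _ := by rw [mul_assoc C, ENNReal.inv_mul_cancel hB0 hfin.ne, mul_one]

lemma LL_le_tsum {m : Measure X} {u : X → ℝ} {x : X} {s : ℝ} {Q : ℕ → ℝ≥0∞}
    (hstep : ∀ k : ℕ, LL m u x (s / 2 ^ k) ≤ LL m u x (s / 2 ^ (k + 1)) + Q k)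
    (hlim : Tendsto (fun k : ℕ => LL m u x (s / 2 ^ k)) atTop (𝓝 0)) :
    LL m u x s ≤ ∑' k, Q k := by
  have h1 : ∀ n : ℕ, LL m u x s ≤ LL m u x (s / 2 ^ n) + ∑ k ∈ Finset.range n, Q k := by
    intro n
    induction n with
    | zero => simp
    | succ n ih =>
      rw [Finset.sum_range_succ]
      calc LL m u x s ≤ _ := ih
        _ ≤ (LL m u x (s / 2 ^ (n + 1)) + Q n) + ∑ k ∈ Finset.range n, Q k := by
            gcongr; exact hstep n
        _ = _ := by ring
  have h2 : Tendsto (fun n : ℕ => LL m u x (s / 2 ^ n) + ∑' k, Q k) atTop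
      (𝓝 (0 + ∑' k, Q k)) := hlim.add tendsto_const_nhds
  rw [zero_add] at h2
  refine ge_of_tendsto' h2 fun n => (h1 n).trans ?_
  gcongr
  exact ENNReal.sum_le_tsum _

/-- The standing local assumptions near `Ω'` at scale `R`. -/
structure Loc (m : Measure X) (p : ℝ) (C_D : ℝ≥0) (C_P lam : ℝ) (Ω Ω' : Set X) (R : ℝ) :
    Prop where
  hp : 1 ≤ p
  hCD : 1 ≤ C_D
  hCP : 0 < C_P
  hlam : 1 ≤ lam
  hR : 0 < R
  dbl : DoublingOn m C_D Ω' R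
  poi : PoincareOn m p C_P lam Ω' R
  cpt : ∀ x ∈ setBall Ω' R, ∀ s, 0 ≤ s → s ≤ R →
        IsCompact (closedBall x s) ∧ closedBall x s ⊆ Ω

/-- Constant in the one-point estimate. -/
def cL (p : ℝ) (C_D : ℝ≥0) (C_P : ℝ) : ℝ≥0∞ :=
  (12 * (C_D : ℝ≥0∞) ^ 2 * ENNReal.ofReal C_P) ^ p

namespace Loc

variable {m : Measure X} {p : ℝ} {C_D : ℝ≥0} {C_P lam : ℝ} {Ω Ω' : Set X} {R : ℝ}

lemma pos (h : Loc m p C_D C_P lam Ω Ω' R) {x : X} (hx : x ∈ setBall Ω' R) {s : ℝ}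
    (hs : 0 < s) (hsR : s ≤ R) : 0 < m (closedBall x s) := by
  have := (h.dbl x hx (s / 2) (by positivity) (by linarith)).1
  rwa [mul_div_cancel₀ _ (by norm_num : (2 : ℝ) ≠ 0)] at this

lemma fin (h : Loc m p C_D C_P lam Ω Ω' R) {x : X} (hx : x ∈ setBall Ω' R) {s : ℝ}
    (hs : 0 < s) (hsR : s ≤ R) : m (closedBall x s) < ⊤ :=
  (h.dbl x hx s hs hsR).2.2

lemma CD0 (h : Loc m p C_D C_P lam Ω Ω' R) : (C_D : ℝ≥0∞) ≠ 0 := by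
  have := h.hCD
  have h2 : C_D ≠ 0 := by
    intro h0; rw [h0] at this; exact absurd this (by norm_num)
  exact_mod_cast h2

lemma one_le_CD (h : Loc m p C_D C_P lam Ω Ω' R) : (1 : ℝ≥0∞) ≤ (C_D : ℝ≥0∞) := by
  exact_mod_cast h.hCD

lemma dd_bound [BorelSpace X] (h : Loc m p C_D C_P lam Ω Ω' R) {u : X → ℝ} (hu : Measurable u)
    {μ : Measure X} [IsFiniteMeasure μ]
    (hμ : ∀ x s, closedBall x s ⊆ Ω → cheegerSet m p Ω u (closedBall x s) ≤ μ (closedBall x s))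
    {x : X} (hx : x ∈ setBall Ω' R) {s : ℝ} (hs : 0 < s) (hsR : 2 * lam * s ≤ R) :
    ∫⁻ y in closedBall x s, ∫⁻ z in closedBall x s, ENNReal.ofReal |u y - u z| ∂m ∂m ≤
      2 * m (closedBall x s) * (m (closedBall x s) * (ENNReal.ofReal (C_P * s) *
        (C_D * avg m μ x (2 * lam * s)) ^ (1 / p))) := by
  have hlam := h.hlam
  have hls : 0 < lam * s := by positivity
  have hsR' : s ≤ R := by nlinarith
  have hlsR : lam * s ≤ R := by nlinarith
  obtain ⟨hc, hsub⟩ := h.cpt x hx (2 * lam * s) (by positivity) hsR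
  refine (poincare_energy h.hp hlam hu hs hc (h.pos hx hs hsR')
    (h.fin hx hs hsR') (h.pos hx hls hlsR)
    (fun w hw => h.poi.2 w hw x hx s hs hsR') (measure_lt_top μ _) (hμ _ _ hsub)).trans ?_
  have hp0 : 0 ≤ 1 / p := by have := h.hp; positivity
  have hk : (m (closedBall x (lam * s)))⁻¹ * μ (closedBall x (2 * lam * s)) ≤
      C_D * avg m μ x (2 * lam * s) := by
    unfold avg
    rw [← mul_assoc]
    apply mul_le_mul' _ le_rfl
    apply ennreal_inv_le_of_le_mul h.CD0 ENNReal.coe_ne_top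
    have := (h.dbl x hx (lam * s) hls hlsR).2.1
    rwa [← mul_assoc] at this
  have hk2 := ENNReal.rpow_le_rpow hk hp0
  exact mul_le_mul_right (mul_le_mul_right (mul_le_mul_right hk2 _) _) _

lemma LL_rpow_le [BorelSpace X] (h : Loc m p C_D C_P lam Ω Ω' R) {u : X → ℝ}
    (hu : Measurable u) {μ : Measure X} [IsFiniteMeasure μ]
    (hμ : ∀ x s, closedBall x s ⊆ Ω → cheegerSet m p Ω u (closedBall x s) ≤ μ (closedBall x s))
    {x : X} (hx : x ∈ setBall Ω' R) {r : ℝ} (hr : 0 < r) (hrR : 4 * lam * r ≤ R)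
    (hleb : Tendsto (fun s => LL m u x s) (𝓝[>] 0) (𝓝 0)) :
    LL m u x (2 * r) ^ p ≤ cL p C_D C_P * (ENNReal.ofReal r ^ p * HH m μ x (4 * lam * r)) := by
  have hp0 : 0 < p := by linarith [h.hp]
  have hlam := h.hlam
  have hip : 0 ≤ 1 / p := by positivity
  have hip1 : 1 / p ≤ 1 := by rw [div_le_one hp0]; exact h.hp
  have hsk : ∀ k : ℕ, 0 < 2 * r / 2 ^ k ∧ 2 * r / 2 ^ k ≤ 2 * r := fun k =>
    ⟨by positivity, div_le_self (by positivity) (one_le_pow₀ (by norm_num))⟩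
  have hhalf : ∀ k : ℕ, 2 * r / 2 ^ (k + 1) = 2 * r / 2 ^ k / 2 := fun k => by
    rw [pow_succ, div_div]
  have hlr : r ≤ lam * r := by nlinarith
  have hstep : ∀ k : ℕ, LL m u x (2 * r / 2 ^ k) ≤ LL m u x (2 * r / 2 ^ (k + 1)) +
      C_D * (2 * (ENNReal.ofReal (C_P * (2 * r / 2 ^ k)) *
        (C_D * avg m μ x (2 * lam * (2 * r / 2 ^ k))) ^ (1 / p))) := by
    intro k
    obtain ⟨h1, h2⟩ := hsk k
    rw [hhalf]
    apply LL_step hu h1 h.CD0 ENNReal.coe_ne_top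
    · exact h.pos hx (by positivity) (by linarith)
    · exact h.fin hx h1 (by linarith)
    · have := (h.dbl x hx (2 * r / 2 ^ k / 2) (by positivity) (by linarith)).2.1
      rwa [mul_div_cancel₀ _ (by norm_num : (2 : ℝ) ≠ 0)] at this
    · apply h.dd_bound hu hμ hx h1
      calc 2 * lam * (2 * r / 2 ^ k) ≤ 2 * lam * (2 * r) := by gcongr
        _ ≤ R := by linarith
  have hlim : Tendsto (fun k : ℕ => LL m u x (2 * r / 2 ^ k)) atTop (𝓝 0) := by
    apply hleb.comp
    rw [tendsto_nhdsWithin_iff]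
    refine ⟨?_, Eventually.of_forall fun k => (hsk k).1⟩
    have := (tendsto_pow_atTop_nhds_zero_of_lt_one (by norm_num : (0 : ℝ) ≤ 1 / 2)
      (by norm_num)).const_mul (2 * r)
    rw [mul_zero] at this
    refine this.congr fun k => ?_
    rw [one_div, inv_pow, div_eq_mul_inv]
  have hsum := LL_le_tsum hstep hlim
  have hterm : ∀ k : ℕ, (C_D : ℝ≥0∞) * (2 * (ENNReal.ofReal (C_P * (2 * r / 2 ^ k)) *
        (C_D * avg m μ x (2 * lam * (2 * r / 2 ^ k))) ^ (1 / p))) ≤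
      (4 * (C_D : ℝ≥0∞) ^ 2 * ENNReal.ofReal C_P * ENNReal.ofReal r) *
        ((1 / 2 : ℝ≥0∞) ^ k * avg m μ x (4 * lam * r / 2 ^ k) ^ (1 / p)) := by
    intro k
    have e1 : ENNReal.ofReal (C_P * (2 * r / 2 ^ k)) =
        2 * ENNReal.ofReal C_P * ENNReal.ofReal r * (1 / 2 : ℝ≥0∞) ^ k := by
      have : C_P * (2 * r / 2 ^ k) = 2 * C_P * r * (1 / 2) ^ k := by
        rw [one_div, inv_pow]; ring
      have hCP := h.hCP
      rw [this, ENNReal.ofReal_mul (by positivity), ENNReal.ofReal_mul (by positivity),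
        ENNReal.ofReal_mul (by positivity), ENNReal.ofReal_pow (by positivity),
        ENNReal.ofReal_div_of_pos (by norm_num)]
      simp
    have e2 : 2 * lam * (2 * r / 2 ^ k) = 4 * lam * r / 2 ^ k := by ring
    have e3 : (C_D : ℝ≥0∞) ^ (1 / p) ≤ C_D := by
      calc (C_D : ℝ≥0∞) ^ (1 / p) ≤ (C_D : ℝ≥0∞) ^ (1 : ℝ) :=
            ENNReal.rpow_le_rpow_of_exponent_le h.one_le_CD hip1
        _ = C_D := ENNReal.rpow_one _
    rw [e1, e2, ENNReal.mul_rpow_of_nonneg _ _ hip]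
    calc _ ≤ (C_D : ℝ≥0∞) * (2 * (2 * ENNReal.ofReal C_P * ENNReal.ofReal r * (1 / 2 : ℝ≥0∞) ^ k *
          (C_D * avg m μ x (4 * lam * r / 2 ^ k) ^ (1 / p)))) := by gcongr
      _ = _ := by ring
  have hsum2 : LL m u x (2 * r) ≤ (4 * (C_D : ℝ≥0∞) ^ 2 * ENNReal.ofReal C_P * ENNReal.ofReal r) *
      ∑' k : ℕ, (1 / 2 : ℝ≥0∞) ^ k * avg m μ x (4 * lam * r / 2 ^ k) ^ (1 / p) := by
    rw [← ENNReal.tsum_mul_left]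
    exact hsum.trans (ENNReal.tsum_le_tsum hterm)
  calc LL m u x (2 * r) ^ p ≤ _ := ENNReal.rpow_le_rpow hsum2 hp0.le
    _ = (4 * (C_D : ℝ≥0∞) ^ 2 * ENNReal.ofReal C_P * ENNReal.ofReal r) ^ p *
      (∑' k : ℕ, (1 / 2 : ℝ≥0∞) ^ k * avg m μ x (4 * lam * r / 2 ^ k) ^ (1 / p)) ^ p :=
        ENNReal.mul_rpow_of_nonneg _ _ hp0.le
    _ ≤ (4 * (C_D : ℝ≥0∞) ^ 2 * ENNReal.ofReal C_P * ENNReal.ofReal r) ^ p *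
      (3 ^ p * HH m μ x (4 * lam * r)) := by
        gcongr
        exact tsum_rpow_le h.hp _
    _ = _ := by
        unfold cL
        rw [← mul_assoc, ← mul_assoc, ← ENNReal.mul_rpow_of_nonneg _ _ hp0.le,
          ← ENNReal.mul_rpow_of_nonneg _ _ hp0.le]
        congr 2
        ring

lemma pair_le [BorelSpace X] (h : Loc m p C_D C_P lam Ω Ω' R) {u : X → ℝ} (hu : Measurable u)
    {x x' : X} (hx : x ∈ setBall Ω' R) {r : ℝ} (hr : 0 < r) (hrR : 2 * r ≤ R)
    (hd : dist x' x ≤ r) (hx' : x' ∈ setBall Ω' R) :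
    ENNReal.ofReal |u x - u x'| ≤
      (C_D : ℝ≥0∞) ^ 2 * (LL m u x (2 * r) + LL m u x' (2 * r)) := by
  have hb0 := h.pos hx hr (by linarith)
  have hbt := h.fin hx hr (by linarith)
  have hB := h.dbl x hx r hr (by linarith)
  have h4 := h.dbl x hx (2 * r) (by positivity) hrR
  have hB'0 := h.pos hx' (by positivity : 0 < 2 * r) hrR
  have hB't := h.fin hx' (by positivity : 0 < 2 * r) hrR
  have hB0 := h.pos hx (by positivity : 0 < 2 * r) hrR
  have hBt := h.fin hx (by positivity : 0 < 2 * r) hrR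
  set b := m (closedBall x r) with hb
  have e1 : m (closedBall x (2 * r)) ≤ (C_D : ℝ≥0∞) ^ 2 * b := by
    refine hB.2.1.trans ?_
    gcongr
    calc (C_D : ℝ≥0∞) = (C_D : ℝ≥0∞) ^ 1 := (pow_one _).symm
      _ ≤ (C_D : ℝ≥0∞) ^ 2 := pow_le_pow_right₀ h.one_le_CD (by norm_num)
  have e2 : m (closedBall x' (2 * r)) ≤ (C_D : ℝ≥0∞) ^ 2 * b := by
    calc m (closedBall x' (2 * r)) ≤ m (closedBall x (2 * (2 * r))) :=
          measure_mono (closedBall_subset_closedBall' (by linarith))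
      _ ≤ C_D * m (closedBall x (2 * r)) := h4.2.1
      _ ≤ C_D * (C_D * b) := by gcongr; exact hB.2.1
      _ = _ := by ring
  have hLx : ∫⁻ y in closedBall x (2 * r), ENNReal.ofReal |u x - u y| ∂m ≤
      (C_D : ℝ≥0∞) ^ 2 * b * LL m u x (2 * r) := by
    calc _ = m (closedBall x (2 * r)) * LL m u x (2 * r) := by
          unfold LL
          rw [← mul_assoc, ENNReal.mul_inv_cancel hB0.ne' hBt.ne, one_mul]
      _ ≤ _ := by gcongr
  have hLx' : ∫⁻ y in closedBall x' (2 * r), ENNReal.ofReal |u x' - u y| ∂m ≤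
      (C_D : ℝ≥0∞) ^ 2 * b * LL m u x' (2 * r) := by
    calc _ = m (closedBall x' (2 * r)) * LL m u x' (2 * r) := by
          unfold LL
          rw [← mul_assoc, ENNReal.mul_inv_cancel hB'0.ne' hB't.ne, one_mul]
      _ ≤ _ := by gcongr
  have key : b * ENNReal.ofReal |u x - u x'| ≤
      b * ((C_D : ℝ≥0∞) ^ 2 * (LL m u x (2 * r) + LL m u x' (2 * r))) := by
    calc b * ENNReal.ofReal |u x - u x'|
        = ∫⁻ y in closedBall x r, ENNReal.ofReal |u x - u x'| ∂m := by
          rw [setLIntegral_const, mul_comm]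
      _ ≤ ∫⁻ y in closedBall x r,
            (ENNReal.ofReal |u x - u y| + ENNReal.ofReal |u x' - u y|) ∂m := by
          apply lintegral_mono
          intro y
          simp only
          rw [abs_sub_comm (u x') (u y)]
          exact ofReal_abs_triangle _ _ _
      _ = ∫⁻ y in closedBall x r, ENNReal.ofReal |u x - u y| ∂m +
            ∫⁻ y in closedBall x r, ENNReal.ofReal |u x' - u y| ∂m :=
          lintegral_add_left (by fun_prop) _
      _ ≤ ∫⁻ y in closedBall x (2 * r), ENNReal.ofReal |u x - u y| ∂m +
            ∫⁻ y in closedBall x' (2 * r), ENNReal.ofReal |u x' - u y| ∂m := by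
          gcongr
          · linarith
          · apply closedBall_subset_closedBall'
            rw [dist_comm]; linarith
      _ ≤ (C_D : ℝ≥0∞) ^ 2 * b * LL m u x (2 * r) + (C_D : ℝ≥0∞) ^ 2 * b * LL m u x' (2 * r) :=
          add_le_add hLx hLx'
      _ = _ := by ring
  exact (ENNReal.mul_le_mul_iff_right hb0.ne' hbt.ne).1 key

end Loc

/-- Constant in the two-point estimate. -/
def c0 (p : ℝ) (C_D : ℝ≥0) (C_P : ℝ) : ℝ≥0∞ :=
  ((C_D : ℝ≥0∞) ^ 2) ^ p * 2 ^ (p - 1) * cL p C_D C_P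

lemma c0_ne_top {p : ℝ} (hp : 1 ≤ p) (C_D : ℝ≥0) (C_P : ℝ) : c0 p C_D C_P ≠ ⊤ := by
  unfold c0 cL
  have hp0 : 0 ≤ p := by linarith
  refine ENNReal.mul_ne_top (ENNReal.mul_ne_top ?_ ?_) ?_
  · exact ENNReal.rpow_ne_top_of_nonneg hp0 (ENNReal.pow_ne_top ENNReal.coe_ne_top)
  · exact ENNReal.rpow_ne_top_of_nonneg (by linarith) (by simp)
  · apply ENNReal.rpow_ne_top_of_nonneg hp0
    exact ENNReal.mul_ne_top (ENNReal.mul_ne_top (by simp) (ENNReal.pow_ne_top ENNReal.coe_ne_top))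
      ENNReal.ofReal_ne_top

lemma Loc.pair_rpow_le [BorelSpace X] {m : Measure X} {p : ℝ} {C_D : ℝ≥0} {C_P lam : ℝ}
    {Ω Ω' : Set X} {R : ℝ} (h : Loc m p C_D C_P lam Ω Ω' R) {u : X → ℝ} (hu : Measurable u)
    {μ : Measure X} [IsFiniteMeasure μ]
    (hμ : ∀ x s, closedBall x s ⊆ Ω → cheegerSet m p Ω u (closedBall x s) ≤ μ (closedBall x s))
    {x x' : X} (hx : x ∈ setBall Ω' R) (hx' : x' ∈ setBall Ω' R) {r : ℝ} (hr : 0 < r)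
    (hrR : 4 * lam * r ≤ R) (hd : dist x' x ≤ r)
    (hleb : Tendsto (fun s => LL m u x s) (𝓝[>] 0) (𝓝 0))
    (hleb' : Tendsto (fun s => LL m u x' s) (𝓝[>] 0) (𝓝 0)) :
    ENNReal.ofReal |u x - u x'| ^ p ≤ c0 p C_D C_P *
      (ENNReal.ofReal r ^ p * (HH m μ x (4 * lam * r) + HH m μ x' (4 * lam * r))) := by
  have hp0 : 0 < p := by linarith [h.hp]
  have hlam := h.hlam
  have h2r : 2 * r ≤ R := by nlinarith
  calc ENNReal.ofReal |u x - u x'| ^ p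
      ≤ ((C_D : ℝ≥0∞) ^ 2 * (LL m u x (2 * r) + LL m u x' (2 * r))) ^ p :=
        ENNReal.rpow_le_rpow (h.pair_le hu hx hr h2r hd hx') hp0.le
    _ = ((C_D : ℝ≥0∞) ^ 2) ^ p * (LL m u x (2 * r) + LL m u x' (2 * r)) ^ p :=
        ENNReal.mul_rpow_of_nonneg _ _ hp0.le
    _ ≤ ((C_D : ℝ≥0∞) ^ 2) ^ p * (2 ^ (p - 1) *
          (LL m u x (2 * r) ^ p + LL m u x' (2 * r) ^ p)) := by
        gcongr
        exact ENNReal.rpow_add_le_mul_rpow_add_rpow _ _ h.hp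
    _ ≤ ((C_D : ℝ≥0∞) ^ 2) ^ p * (2 ^ (p - 1) *
          (cL p C_D C_P * (ENNReal.ofReal r ^ p * HH m μ x (4 * lam * r)) +
            cL p C_D C_P * (ENNReal.ofReal r ^ p * HH m μ x' (4 * lam * r)))) := by
        gcongr
        · exact h.LL_rpow_le hu hμ hx hr hrR hleb
        · exact h.LL_rpow_le hu hμ hx' hr hrR hleb'
    _ = _ := by unfold c0; ring


/-! ### Lebesgue points -/

lemma ae_LL_tendsto [BorelSpace X] [SecondCountableTopology X]
    (hloc : ∀ x : X, ∃ r > 0, IsComplete (closedBall x r)) {m : Measure X}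
    [IsLocallyFiniteMeasure m] {C_D : ℝ≥0} (hD : InternallyDoubling m C_D)
    {g : X → ℝ} (hg : LocallyIntegrable g m) :
    ∀ᵐ x ∂m, Tendsto (fun s => LL m g x s) (𝓝[>] 0) (𝓝 0) := by
  have h3 : ∀ x : X, ∀ᶠ r in 𝓝[>] (0 : ℝ),
      m (closedBall x (3 * r)) ≤ ((C_D ^ 2 : ℝ≥0) : ℝ≥0∞) * m (closedBall x r) := by
    intro x
    obtain ⟨R, hR, hd⟩ := hD.2 {x} (wellInside_singleton hloc x)
    have hx : x ∈ setBall {x} R := subset_setBall rfl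
    filter_upwards [Ioc_mem_nhdsGT (by positivity : 0 < R / 2)] with r hr
    calc m (closedBall x (3 * r)) ≤ m (closedBall x (2 * (2 * r))) :=
          measure_mono (closedBall_subset_closedBall (by linarith [hr.1]))
      _ ≤ C_D * m (closedBall x (2 * r)) := (hd x hx (2 * r) (by linarith [hr.1])
          (by linarith [hr.2])).2.1
      _ ≤ C_D * (C_D * m (closedBall x r)) := by
          gcongr
          exact (hd x hx r hr.1 (by linarith [hr.2])).2.1
      _ = _ := by push_cast; ring
  set v := Vitali.vitaliFamily m (C_D ^ 2) fun x => (h3 x).frequently with hv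
  filter_upwards [v.ae_tendsto_lintegral_enorm_sub_div hg] with x hx
  have ht : Tendsto (fun r : ℝ => closedBall x r) (𝓝[>] 0) (v.filterAt x) := by
    rw [VitaliFamily.tendsto_filterAt_iff]
    constructor
    · filter_upwards [h3 x, self_mem_nhdsWithin] with r hr hr0
      exact ⟨isClosed_closedBall, (nonempty_ball.2 hr0).mono ball_subset_interior_closedBall,
        r, Subset.rfl, hr⟩
    · intro ε hε
      filter_upwards [Ioc_mem_nhdsGT hε] with r hr
      exact closedBall_subset_closedBall hr.2
  refine (hx.comp ht).congr fun r => ?_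
  simp only [Function.comp, LL]
  rw [ENNReal.div_eq_inv_mul]
  congr 1
  apply lintegral_congr
  intro y
  rw [Real.enorm_eq_ofReal_abs, abs_sub_comm]

lemma locallyIntegrable_of_bdd [BorelSpace X] {m : Measure X} [IsLocallyFiniteMeasure m]
    {u : X → ℝ} (hu : Measurable u) {M : ℝ} (hM : ∀ x, |u x| ≤ M) : LocallyIntegrable u m := by
  have hc : LocallyIntegrable (fun _ : X => M) m := locallyIntegrable_const M
  refine hc.mono hu.aestronglyMeasurable (ae_of_all _ fun x => ?_)
  simp only [Real.norm_eq_abs]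
  exact (hM x).trans (le_abs_self _)

/-! ### The two-point estimate for the metric-valued map -/

lemma exists_energy_measure {m : Measure X} {Ω : Set X} (hΩ : MeasurableSet Ω)
    {ν : OuterMeasure X} (hν : IsBorelRegularOM ν) (hfin : ν Ω < ⊤)
    (hac : ∀ S, S ⊆ Ω → m S = 0 → ν S = 0) :
    ∃ μ : Measure X, IsFiniteMeasure μ ∧ μ ≪ m ∧
      ∀ S, MeasurableSet S → S ⊆ Ω → ν S ≤ μ S := by
  have hle : (‹MeasurableSpace X›) ≤ ν.caratheodory := fun B hB => hν.1 B hB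
  refine ⟨(ν.toMeasure hle).restrict Ω, ?_, ?_, ?_⟩
  · constructor
    rw [Measure.restrict_apply_univ, toMeasure_apply _ _ hΩ]
    exact hfin
  · refine Measure.AbsolutelyContinuous.mk fun S hS h0 => ?_
    rw [Measure.restrict_apply hS, toMeasure_apply _ _ (hS.inter hΩ)]
    exact hac _ inter_subset_right (measure_mono_null inter_subset_left h0)
  · intro S hS hSΩ
    rw [Measure.restrict_apply hS, inter_eq_self_of_subset_left hSΩ, toMeasure_apply _ _ hS]

lemma MemB.aestronglyMeasurable {m : Measure X} {Ω : Set X} (hΩ : MeasurableSet Ω)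
    {Y : Type*} [MetricSpace Y] {f : X → Y} (hf : MemB m Ω f) :
    AEStronglyMeasurable f (m.restrict Ω) := by
  let _ : MeasurableSpace Y := borel Y
  have : BorelSpace Y := ⟨rfl⟩
  obtain ⟨h1, N, hN, hN0, hsep⟩ := hf
  rw [aestronglyMeasurable_iff_aemeasurable_separable]
  refine ⟨aemeasurable_restrict_of_measurable_subtype hΩ h1, _, hsep, ?_⟩
  rw [ae_restrict_iff' hΩ]
  have : ∀ᵐ x ∂m, x ∉ N := measure_eq_zero_iff_ae_notMem.1 hN0
  filter_upwards [this] with x hx hxΩ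
  exact mem_image_of_mem f ⟨hxΩ, hx⟩

lemma cheegerSet_congr_le {m : Measure X} {p : ℝ} {Ω : Set X} {u w : X → ℝ}
    (h : u =ᵐ[m.restrict Ω] w) (S : Set X) :
    cheegerSet m p Ω w S ≤ cheegerSet m p Ω u S := by
  unfold cheegerSet
  refine iInf_mono fun O => iInf_mono fun hO => iInf_mono fun hOΩ => iInf_mono fun hS => ?_
  unfold cheegerOpen
  refine iInf_mono fun v => iInf_mono fun hv => ?_
  refine le_iInf fun ht => iInf_le_of_le ?_ le_rfl
  intro x hx
  obtain ⟨r, hr, ht⟩ := ht x hx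
  refine ⟨r, hr, ht.congr fun n => ?_⟩
  apply lintegral_congr_ae
  have h' : u =ᵐ[m.restrict (O ∩ closedBall x r)] w :=
    ae_restrict_of_ae_restrict_of_subset (inter_subset_left.trans hOΩ) h
  filter_upwards [h'] with y hy
  rw [hy]

lemma edist_le_of_trunc {Y : Type*} [MetricSpace Y] {C : Set Y} {y y' : Y} (hy : y ∈ closure C)
    {b : ℝ≥0∞}
    (h : ∀ c ∈ C, ∀ M : ℕ, ENNReal.ofReal |min (dist y c) M - min (dist y' c) M| ≤ b) :
    edist y y' ≤ b := by
  apply ENNReal.le_of_forall_pos_le_add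
  intro ε hε _
  obtain ⟨c, hc, hyc⟩ := Metric.mem_closure_iff.1 hy (ε / 2) (by positivity)
  obtain ⟨M, hM⟩ := exists_nat_ge (max (dist y c) (dist y' c))
  have h1 := h c hc M
  rw [min_eq_left ((le_max_left _ _).trans hM), min_eq_left ((le_max_right _ _).trans hM)] at h1
  have h2 : dist y y' ≤ |dist y c - dist y' c| + ε := by
    have := dist_triangle_right y y' c
    have h3 := neg_abs_le (dist y c - dist y' c)
    linarith
  rw [edist_dist]
  calc ENNReal.ofReal (dist y y') ≤ ENNReal.ofReal (|dist y c - dist y' c| + ε) :=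
        ENNReal.ofReal_le_ofReal h2
    _ ≤ ENNReal.ofReal (|dist y c - dist y' c|) + ENNReal.ofReal ε := ENNReal.ofReal_add_le
    _ ≤ b + ε := by
        gcongr
        simp

lemma bddLip1_trunc {Y : Type*} [MetricSpace Y] (c : Y) (M : ℕ) :
    BddLip1 fun y : Y => min (dist y c) M := by
  refine ⟨⟨M, fun y => ?_⟩, ?_⟩
  · rw [abs_of_nonneg (le_min dist_nonneg (Nat.cast_nonneg _))]
    exact min_le_right _ _
  · simpa using (LipschitzWith.dist_left c).min_const (M : ℝ)

/-- The two-point estimate on a set of full measure. -/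
lemma exists_two_point [BorelSpace X] [SecondCountableTopology X]
    (hloc : ∀ x : X, ∃ r > 0, IsComplete (closedBall x r)) {m : Measure X}
    [IsLocallyFiniteMeasure m] {C_D : ℝ≥0} (hD : InternallyDoubling m C_D)
    {p C_P lam : ℝ} {Ω Ω' : Set X} {R : ℝ} (hΩ : MeasurableSet Ω)
    (h : Loc m p C_D C_P lam Ω Ω' R)
    {Y : Type*} [MetricSpace Y] {f : X → Y} (hf : MemSobolevClass m p Ω f) :
    ∃ μ : Measure X, IsFiniteMeasure μ ∧ μ ≪ m ∧ ∃ G : Set X, (∀ᵐ x ∂m.restrict Ω, x ∈ G) ∧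
      ∀ x ∈ G, ∀ x' ∈ G, x ∈ setBall Ω' R → x' ∈ setBall Ω' R → ∀ r, 0 < r → 4 * lam * r ≤ R →
        dist x' x ≤ r → edist (f x) (f x') ^ p ≤ c0 p C_D C_P *
          (ENNReal.ofReal r ^ p * (HH m μ x (4 * lam * r) + HH m μ x' (4 * lam * r))) := by
  obtain ⟨hB, ν, hν, hfin, hac⟩ := hf
  obtain ⟨μ, hμf, hμac, hμ⟩ := exists_energy_measure hΩ hν.1 hfin hac
  have hae := hB.aestronglyMeasurable hΩ
  set F := hae.mk f with hF
  have hFm : StronglyMeasurable F := hae.stronglyMeasurable_mk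
  have hfF : f =ᵐ[m.restrict Ω] F := hae.ae_eq_mk
  obtain ⟨C, hCc, hCd⟩ := hFm.isSeparable_range
  have hp0 : 0 < p := by linarith [h.hp]
  have hum : ∀ (c : Y) (M : ℕ), Measurable fun x => min (dist (F x) c) M := fun c M =>
    ((hFm.dist stronglyMeasurable_const).measurable).min measurable_const
  refine ⟨μ, hμf, hμac,
    {x | f x = F x ∧ ∀ c ∈ C, ∀ M : ℕ,
      Tendsto (fun s => LL m (fun x => min (dist (F x) c) M) x s) (𝓝[>] 0) (𝓝 0)}, ?_, ?_⟩
  · have h1 : ∀ᵐ x ∂m, ∀ c ∈ C, ∀ M : ℕ,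
        Tendsto (fun s => LL m (fun x => min (dist (F x) c) M) x s) (𝓝[>] 0) (𝓝 0) := by
      rw [ae_ball_iff hCc]
      intro c hc
      rw [ae_all_iff]
      intro M
      refine ae_LL_tendsto hloc hD (locallyIntegrable_of_bdd (hum c M) (M := M) fun x => ?_)
      rw [abs_of_nonneg (le_min dist_nonneg (Nat.cast_nonneg _))]
      exact min_le_right _ _
    filter_upwards [hfF, ae_restrict_of_ae h1] with x hx1 hx2
    exact ⟨hx1, hx2⟩
  · rintro x ⟨hx1, hx2⟩ x' ⟨hx1', hx2'⟩ hx hx' r hr hrR hd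
    rw [hx1, hx1']
    set A := c0 p C_D C_P *
          (ENNReal.ofReal r ^ p * (HH m μ x (4 * lam * r) + HH m μ x' (4 * lam * r))) with hA
    have key : edist (F x) (F x') ≤ A ^ p⁻¹ := by
      apply edist_le_of_trunc (hCd (mem_range_self x))
      intro c hc M
      rw [ENNReal.le_rpow_inv_iff hp0]
      refine h.pair_rpow_le (u := fun x => min (dist (F x) c) M) (hum c M) ?_ hx hx' hr hrR hd
        (hx2 c hc M) (hx2' c hc M)
      intro z s hzs
      have e1 : (fun y : Y => min (dist y c) (M : ℝ)) ∘ f =ᵐ[m.restrict Ω]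
          fun x => min (dist (F x) c) M := by
        filter_upwards [hfF] with x hx
        simp [hx]
      exact (cheegerSet_congr_le e1 _).trans ((hν.2.1 _ hzs _ (bddLip1_trunc c M)).trans
        (hμ _ measurableSet_closedBall hzs))
    exact (ENNReal.le_rpow_inv_iff hp0).1 key

/-! ### Pointwise convergence -/

/-- The two-point estimate as a hypothesis. -/
structure TP (m : Measure X) (p : ℝ) (c : ℝ≥0∞) (lam : ℝ) (Ω Ω' : Set X) (R : ℝ)
    {Y : Type*} [MetricSpace Y] (f : X → Y) (μ : Measure X) (G : Set X) : Prop where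
  ae : ∀ᵐ x ∂m.restrict Ω, x ∈ G
  two : ∀ x ∈ G, ∀ x' ∈ G, x ∈ setBall Ω' R → x' ∈ setBall Ω' R → ∀ r, 0 < r → 4 * lam * r ≤ R →
        dist x' x ≤ r → edist (f x) (f x') ^ p ≤ c *
          (ENNReal.ofReal r ^ p * (HH m μ x (4 * lam * r) + HH m μ x' (4 * lam * r)))

section
variable [BorelSpace X] [SecondCountableTopology X]
  {m : Measure X} [SFinite m] {p : ℝ} {C_D : ℝ≥0} {C_P lam : ℝ} {Ω Ω' : Set X} {R : ℝ}
  {Y : Type*} [MetricSpace Y] {f : X → Y} {μ : Measure X} [SFinite μ] {G : Set X} {c : ℝ≥0∞}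

lemma mem_setBall_near {x x' : X} (hx : x ∈ Ω') {r : ℝ} (hr : 0 ≤ r) (hrR : r ≤ R)
    (hd : dist x' x ≤ r) : x' ∈ setBall Ω' R := by
  have := mem_setBall_of_dist_le le_rfl hr (subset_setBall (a := 0) hx) hd
  rw [zero_add] at this
  exact setBall_mono hrR this

lemma ks_le (h : Loc m p C_D C_P lam Ω Ω' R) (ht : TP m p c lam Ω Ω' R f μ G)
    {E : Set X} (hE : MeasurableSet E) (hEΩ : E ⊆ Ω) {x : X} (hx : x ∈ Ω') (hxG : x ∈ G)
    {r : ℝ} (hr : 0 < r) (hrR : 4 * lam * r ≤ R) :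
    ks m p f E x r ≤ c * (HH m μ x (4 * lam * r) *
        ((m (closedBall x r))⁻¹ * m (closedBall x r ∩ E)) +
      (m (closedBall x r))⁻¹ * ∫⁻ x' in closedBall x r ∩ E, HH m μ x' (4 * lam * r) ∂m) := by
  have hp0 : 0 < p := by linarith [h.hp]
  have hlam := h.hlam
  have hrR' : r ≤ R := by nlinarith
  have hr0 : ENNReal.ofReal r ^ p ≠ 0 := by
    simp [ENNReal.rpow_eq_zero_iff, hr, hp0.le, hp0]
  have hrt : ENNReal.ofReal r ^ p ≠ ⊤ := ENNReal.rpow_ne_top_of_nonneg hp0.le ENNReal.ofReal_ne_top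
  have key : ∫⁻ x' in closedBall x r ∩ E, edist (f x) (f x') ^ p / ENNReal.ofReal r ^ p ∂m ≤
      ∫⁻ x' in closedBall x r ∩ E, c * (HH m μ x (4 * lam * r) + HH m μ x' (4 * lam * r)) ∂m := by
    apply lintegral_mono_ae
    have h1 : ∀ᵐ x' ∂m.restrict (closedBall x r ∩ E), x' ∈ G :=
      ae_restrict_of_ae_restrict_of_subset (inter_subset_right.trans hEΩ) ht.ae
    filter_upwards [h1, ae_restrict_mem (measurableSet_closedBall.inter hE)] with x' hx' hx'B
    rw [ENNReal.div_le_iff hr0 hrt]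
    refine (ht.two x hxG x' hx' (subset_setBall hx) (mem_setBall_near hx hr.le hrR' hx'B.1)
      r hr hrR hx'B.1).trans (le_of_eq ?_)
    ring
  unfold ks
  refine (mul_le_mul_right key _).trans (le_of_eq ?_)
  rw [lintegral_const_mul _ ((measurable_HH m μ _).const_add _), lintegral_add_left measurable_const,
    setLIntegral_const]
  ring

lemma Loc.dbl_pow (h : Loc m p C_D C_P lam Ω Ω' R) {x : X} (hx : x ∈ setBall Ω' R) {r : ℝ}
    (hr : 0 < r) (k : ℕ) (hk : 2 ^ k * r ≤ R) :
    m (closedBall x (2 ^ k * r)) ≤ (C_D : ℝ≥0∞) ^ k * m (closedBall x r) := by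
  have := doubling_iterate (m := m) (C := C_D) (y := x) (by positivity : 0 < 2 ^ k * r)
    (fun s hs hsR => (h.dbl x hx s hs (hsR.trans hk)).2.1) k
  rwa [mul_div_cancel_left₀ _ (by positivity)] at this

lemma Loc.lintegral_HH_ball (h : Loc m p C_D C_P lam Ω Ω' R) {E : Set X} (hE : MeasurableSet E)
    (hES : E ⊆ setBall Ω' R) (τ : Measure X) [SFinite τ] {t : ℝ} (ht : 0 < t) (htR : t ≤ R) :
    ∫⁻ x in E, HH m τ x t ∂m ≤ 4 * (C_D * τ univ) := by
  apply lintegral_HH_le m τ t E hE h.CD0 ENNReal.coe_ne_top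
  intro x hx k
  exact (h.dbl x (hES hx) (t / 2 ^ k) (by positivity)
    ((div_le_self ht.le (one_le_pow₀ (by norm_num))).trans htR)).2.1

lemma withDensity_closedBall_le {g : X → ℝ} (hg : Measurable g) (x : X) (S : Set X)
    (hS : MeasurableSet S) :
    m.withDensity (fun y => ENNReal.ofReal (g y)) S ≤
      ENNReal.ofReal (g x) * m S + m.withDensity (fun y => ENNReal.ofReal |g x - g y|) S := by
  rw [withDensity_apply _ hS, withDensity_apply _ hS, ← setLIntegral_const,
    ← lintegral_add_left measurable_const]
  apply lintegral_mono
  intro y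
  refine le_trans ?_ ENNReal.ofReal_add_le
  apply ENNReal.ofReal_le_ofReal
  have := neg_abs_le (g x - g y)
  linarith

lemma avg_withDensity_eq_LL (g : X → ℝ) (x : X) (s : ℝ) :
    avg m (m.withDensity (fun y => ENNReal.ofReal |g x - g y|)) x s = LL m g x s := by
  unfold avg LL
  rw [withDensity_apply _ measurableSet_closedBall]

lemma avg_le_const {a : ℝ≥0∞} {μ' : Measure X} {x : X} {s : ℝ}
    (h : μ' (closedBall x s) ≤ a * m (closedBall x s)) : avg m μ' x s ≤ a := by
  unfold avg
  calc (m (closedBall x s))⁻¹ * μ' (closedBall x s)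
      ≤ (m (closedBall x s))⁻¹ * (a * m (closedBall x s)) := by gcongr
    _ = a * ((m (closedBall x s))⁻¹ * m (closedBall x s)) := by ring
    _ ≤ a * 1 := by gcongr; exact ENNReal.inv_mul_le_one _
    _ = a := mul_one _

lemma avg_le_LL {g : X → ℝ} (hg : Measurable g)
    (hμ : μ = m.withDensity fun y => ENNReal.ofReal (g y)) (x : X) (s : ℝ) :
    avg m μ x s ≤ ENNReal.ofReal (g x) + LL m g x s := by
  set τ := m.withDensity (fun y => ENNReal.ofReal |g x - g y|) with hτ
  calc avg m μ x s ≤ avg m (ENNReal.ofReal (g x) • m + τ) x s := by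
        apply avg_mono_of_le
        rw [hμ]
        simpa using withDensity_closedBall_le (m := m) hg x _ measurableSet_closedBall
    _ = avg m (ENNReal.ofReal (g x) • m) x s + avg m τ x s := avg_add _ _ _ _ _
    _ ≤ _ := by
        rw [hτ, avg_withDensity_eq_LL]
        gcongr
        exact avg_le_const (by simp)

lemma lintegral_HH_near (h : Loc m p C_D C_P lam Ω Ω' R)
    {g : X → ℝ} (hg : Measurable g)
    (hμ : μ = m.withDensity fun y => ENNReal.ofReal (g y))
    {E : Set X} {x : X} (hx : x ∈ Ω') {r t : ℝ} (hr : 0 < r) (ht : 0 < t) (k : ℕ)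
    (hkt : r + t ≤ 2 ^ k * r) (hkR : 2 ^ k * r ≤ R) :
    (m (closedBall x r))⁻¹ * ∫⁻ x' in closedBall x r ∩ E, HH m μ x' t ∂m ≤
      4 * ENNReal.ofReal (g x) * ((m (closedBall x r))⁻¹ * m (closedBall x r ∩ E)) +
      4 * (C_D * ((C_D : ℝ≥0∞) ^ k * LL m g x (r + t))) := by
  set τ := m.withDensity (fun y => ENNReal.ofReal |g x - g y|) with hτ
  set τ' := τ.restrict (closedBall x (r + t)) with hτ'
  set B := closedBall x r with hB
  have hrtR : r + t ≤ R := hkt.trans hkR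
  have hBS : B ⊆ setBall Ω' R := fun x' hx' =>
    mem_setBall_near hx hr.le (by linarith) hx'
  have h1 : ∀ x' ∈ B, HH m μ x' t ≤ 4 * ENNReal.ofReal (g x) + HH m τ' x' t := by
    intro x' hx'
    calc HH m μ x' t ≤ HH m (ENNReal.ofReal (g x) • m + τ') x' t := by
          apply HH_mono_of_le
          intro j
          have hj : t / 2 ^ j ≤ t := div_le_self ht.le (one_le_pow₀ (by norm_num))
          have hsub : closedBall x' (t / 2 ^ j) ⊆ closedBall x (r + t) :=
            closedBall_subset_closedBall' (by have := mem_closedBall.1 hx'; linarith)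
          rw [hμ, Measure.add_apply, hτ', Measure.restrict_apply measurableSet_closedBall,
            inter_eq_self_of_subset_left hsub]
          simpa using withDensity_closedBall_le (m := m) hg x _ measurableSet_closedBall
      _ = HH m (ENNReal.ofReal (g x) • m) x' t + HH m τ' x' t := HH_add _ _ _ _ _
      _ ≤ _ := by
          gcongr
          exact HH_le_of_avg_le fun j => avg_le_const (by simp)
  have h2 : ∫⁻ x' in B ∩ E, HH m μ x' t ∂m ≤
      4 * ENNReal.ofReal (g x) * m (B ∩ E) + 4 * (C_D * τ' univ) := by
    calc ∫⁻ x' in B ∩ E, HH m μ x' t ∂m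
        ≤ ∫⁻ x' in B ∩ E, (4 * ENNReal.ofReal (g x) + HH m τ' x' t) ∂m := by
          refine setLIntegral_mono_ae
            ((measurable_HH m τ' t).const_add _).aemeasurable (ae_of_all _ fun x' hx' => h1 x' hx'.1)
      _ = 4 * ENNReal.ofReal (g x) * m (B ∩ E) + ∫⁻ x' in B ∩ E, HH m τ' x' t ∂m := by
          rw [lintegral_add_left measurable_const, setLIntegral_const]
      _ ≤ _ := by
          gcongr
          exact (lintegral_mono_set inter_subset_left).trans
            (h.lintegral_HH_ball measurableSet_closedBall hBS τ' ht (by linarith))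
  have hB0 := h.pos (subset_setBall hx) hr (by linarith)
  have hBt := h.fin (subset_setBall hx) hr (by linarith)
  have hB0' := h.pos (subset_setBall hx) (by positivity : 0 < r + t) hrtR
  have hBt' := h.fin (subset_setBall hx) (by positivity : 0 < r + t) hrtR
  have h3 : τ' univ ≤ (C_D : ℝ≥0∞) ^ k * m B * LL m g x (r + t) := by
    have : τ' univ = m (closedBall x (r + t)) * LL m g x (r + t) := by
      rw [hτ', Measure.restrict_apply_univ, ← avg_withDensity_eq_LL, avg, ← mul_assoc,
        ENNReal.mul_inv_cancel hB0'.ne' hBt'.ne, one_mul]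
    rw [this]
    gcongr
    exact (measure_mono (closedBall_subset_closedBall hkt)).trans
      (h.dbl_pow (subset_setBall hx) hr k hkR)
  calc (m B)⁻¹ * ∫⁻ x' in B ∩ E, HH m μ x' t ∂m
      ≤ (m B)⁻¹ * (4 * ENNReal.ofReal (g x) * m (B ∩ E) +
          4 * (C_D * ((C_D : ℝ≥0∞) ^ k * m B * LL m g x (r + t)))) := by
        gcongr
        refine h2.trans ?_
        gcongr
    _ = 4 * ENNReal.ofReal (g x) * ((m B)⁻¹ * m (B ∩ E)) +
          (m B)⁻¹ * m B * (4 * (C_D * ((C_D : ℝ≥0∞) ^ k * LL m g x (r + t)))) := by ring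
    _ = _ := by rw [ENNReal.inv_mul_cancel hB0.ne' hBt.ne, one_mul]

lemma tendsto_mul_pos {a : ℝ} (ha : 0 < a) : Tendsto (fun r : ℝ => a * r) (𝓝[>] 0) (𝓝[>] 0) := by
  rw [tendsto_nhdsWithin_iff]
  constructor
  · have : Tendsto (fun r : ℝ => a * r) (𝓝 0) (𝓝 (a * 0)) := (continuous_const_mul a).tendsto 0
    rw [mul_zero] at this
    exact this.mono_left nhdsWithin_le_nhds
  · filter_upwards [self_mem_nhdsWithin] with r hr
    exact mul_pos ha hr

lemma ks_tendsto_zero (h : Loc m p C_D C_P lam Ω Ω' R) (ht : TP m p c lam Ω Ω' R f μ G)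
    (hc : c ≠ ⊤) {g : X → ℝ} (hg : Measurable g)
    (hμ : μ = m.withDensity fun y => ENNReal.ofReal (g y))
    {E : Set X} (hE : MeasurableSet E) (hEΩ : E ⊆ Ω) {x : X} (hx : x ∈ Ω') (hxG : x ∈ G)
    (hLL : Tendsto (fun s => LL m g x s) (𝓝[>] 0) (𝓝 0))
    (hdens : Tendsto (fun r => (m (closedBall x r))⁻¹ * m (closedBall x r ∩ E)) (𝓝[>] 0) (𝓝 0)) :
    Tendsto (fun r => ks m p f E x r) (𝓝[>] 0) (𝓝 0) := by
  have hlam := h.hlam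
  have hR := h.hR
  obtain ⟨k, hk⟩ := pow_unbounded_of_one_lt (1 + 4 * lam) (by norm_num : (1 : ℝ) < 2)
  set D : ℝ → ℝ≥0∞ := fun r => (m (closedBall x r))⁻¹ * m (closedBall x r ∩ E) with hD
  have hbd : ∀ᶠ r in 𝓝[>] (0 : ℝ), HH m μ x (4 * lam * r) ≤ 4 * (ENNReal.ofReal (g x) + 1) := by
    have h1 : ∀ᶠ s in 𝓝[>] (0 : ℝ), LL m g x s < 1 :=
      hLL.eventually (gt_mem_nhds (by norm_num))
    obtain ⟨δ, hδ, hδ'⟩ := mem_nhdsGT_iff_exists_Ioc_subset.1 h1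
    filter_upwards [Ioc_mem_nhdsGT (by have : 0 < δ := hδ; positivity : 0 < δ / (4 * lam))]
      with r hr
    apply HH_le_of_avg_le
    intro j
    refine (avg_le_LL hg hμ x _).trans ?_
    gcongr
    have hr0 := hr.1
    have : 4 * lam * r / 2 ^ j ∈ Ioc (0 : ℝ) δ := by
      refine ⟨by positivity, (div_le_self (by positivity) (one_le_pow₀ (by norm_num))).trans ?_⟩
      have := hr.2
      rw [le_div_iff₀ (by positivity)] at this
      linarith
    exact (hδ' this).le
  have hmain : ∀ᶠ r in 𝓝[>] (0 : ℝ), ks m p f E x r ≤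
      c * (4 * (ENNReal.ofReal (g x) + 1) * D r + (4 * ENNReal.ofReal (g x) * D r +
        4 * (C_D * ((C_D : ℝ≥0∞) ^ k * LL m g x ((1 + 4 * lam) * r))))) := by
    filter_upwards [hbd, Ioc_mem_nhdsGT (by positivity : 0 < R / 2 ^ k)] with r hb hr
    have hr0 := hr.1
    have hkR : 2 ^ k * r ≤ R := by
      have := hr.2
      rw [le_div_iff₀ (by positivity)] at this
      linarith
    have hrt : r + 4 * lam * r ≤ 2 ^ k * r := by nlinarith
    refine (ks_le h ht hE hEΩ hx hxG hr0 (by linarith)).trans ?_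
    have h2 := lintegral_HH_near h hg hμ (E := E) hx hr0
      (by positivity : 0 < 4 * lam * r) k hrt hkR
    have e1 : r + 4 * lam * r = (1 + 4 * lam) * r := by ring
    rw [e1] at h2
    gcongr
  have hlim : Tendsto (fun r => c * (4 * (ENNReal.ofReal (g x) + 1) * D r +
      (4 * ENNReal.ofReal (g x) * D r +
        4 * (C_D * ((C_D : ℝ≥0∞) ^ k * LL m g x ((1 + 4 * lam) * r)))))) (𝓝[>] 0) (𝓝 0) := by
    have hL := hLL.comp (tendsto_mul_pos (by positivity : 0 < 1 + 4 * lam))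
    have hgt : ENNReal.ofReal (g x) ≠ ⊤ := ENNReal.ofReal_ne_top
    have t1 := ENNReal.Tendsto.const_mul (a := 4 * (ENNReal.ofReal (g x) + 1)) hdens
      (Or.inr (ENNReal.mul_ne_top (by simp) (by simp)))
    have t2 := ENNReal.Tendsto.const_mul (a := 4 * (ENNReal.ofReal (g x))) hdens
      (Or.inr (ENNReal.mul_ne_top (by simp) hgt))
    have t3 := ENNReal.Tendsto.const_mul (a := (4 * (C_D * (C_D : ℝ≥0∞) ^ k) : ℝ≥0∞)) hL
      (Or.inr (ENNReal.mul_ne_top (by simp) (ENNReal.mul_ne_top ENNReal.coe_ne_top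
        (ENNReal.pow_ne_top ENNReal.coe_ne_top))))
    have t4 := ENNReal.Tendsto.const_mul (a := c) (t1.add (t2.add t3)) (Or.inr hc)
    simp only [mul_zero, add_zero] at t4
    refine t4.congr fun r => ?_
    simp only [Function.comp, hD]
    ring
  exact tendsto_of_tendsto_of_tendsto_of_le_of_le' tendsto_const_nhds hlim
    (Eventually.of_forall fun _ => zero_le) hmain

lemma dens_tendsto {V : Set X} (hV : MeasurableSet V) {x : X}
    (h : Loc m p C_D C_P lam Ω Ω' R) (hx : x ∈ Ω') (hd : IsDensityPoint m V x) :
    Tendsto (fun r => (m (closedBall x r))⁻¹ * m (closedBall x r ∩ (Ω \ V))) (𝓝[>] 0) (𝓝 0) := by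
  have h1 := ENNReal.Tendsto.sub (tendsto_const_nhds (x := (1 : ℝ≥0∞)) (f := 𝓝[>] (0 : ℝ))) hd.2
    (Or.inl (by simp))
  rw [tsub_self] at h1
  refine tendsto_of_tendsto_of_tendsto_of_le_of_le' tendsto_const_nhds h1
    (Eventually.of_forall fun _ => zero_le) ?_
  filter_upwards [Ioc_mem_nhdsGT h.hR] with r hr
  have hB0 := h.pos (subset_setBall hx) hr.1 hr.2
  have hBt := h.fin (subset_setBall hx) hr.1 hr.2
  set B := closedBall x r
  have h2 : m (V ∩ B) / m B + (m B)⁻¹ * m (B ∩ (Ω \ V)) ≤ 1 := by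
    rw [ENNReal.div_eq_inv_mul, ← mul_add, inter_comm V B]
    calc (m B)⁻¹ * (m (B ∩ V) + m (B ∩ (Ω \ V))) ≤ (m B)⁻¹ * (m (B ∩ V) + m (B \ V)) := by
          gcongr
          exact fun y hy => ⟨hy.1, hy.2.2⟩
      _ = (m B)⁻¹ * m B := by rw [measure_inter_add_diff _ hV]
      _ ≤ 1 := ENNReal.inv_mul_le_one _
  refine ENNReal.le_sub_of_add_le_left ?_ h2
  exact ne_top_of_le_ne_top (by simp) (le_self_add.trans h2)

lemma eabs_add_le (a b d : ℝ≥0∞) : eabs (a + b) d ≤ eabs a d + b := by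
  unfold eabs
  apply sup_le
  · rw [tsub_le_iff_right]
    calc a + b ≤ ((a - d) + d) + b := by gcongr; exact le_tsub_add
      _ = (a - d) + b + d := by ring
      _ ≤ _ := by gcongr; exact le_sup_left
  · calc d - (a + b) ≤ d - a := tsub_le_tsub_left le_self_add _
      _ ≤ (a - d) ⊔ (d - a) := le_sup_right
      _ ≤ _ := le_self_add

lemma ks_split {V : Set X} (hV : MeasurableSet V) (hVΩ : V ⊆ Ω) (x : X) (r : ℝ) :
    ks m p f Ω x r = ks m p f V x r + ks m p f (Ω \ V) x r := by
  unfold ks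
  rw [← mul_add, ← lintegral_inter_add_diff _ (closedBall x r ∩ Ω) hV]
  rw [inter_assoc, inter_eq_self_of_subset_right hVΩ, inter_diff_assoc]

lemma tendsto_of_eabs {ι : Type*} {l : Filter ι} {F : ι → ℝ≥0∞} {a : ℝ≥0∞} (ha : a ≠ ⊤)
    (h : Tendsto (fun i => eabs (F i) a) l (𝓝 0)) : Tendsto F l (𝓝 a) := by
  have h1 : Tendsto (fun i => a + eabs (F i) a) l (𝓝 a) := by
    simpa using tendsto_const_nhds.add h
  have h2 : Tendsto (fun i => a - eabs (F i) a) l (𝓝 a) := by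
    simpa using ENNReal.Tendsto.sub (tendsto_const_nhds (x := a)) h (Or.inl ha)
  refine tendsto_of_tendsto_of_tendsto_of_le_of_le h2 h1 (fun i => ?_) fun i => ?_
  · simp only [tsub_le_iff_right]
    calc a ≤ (a - F i) + F i := le_tsub_add
      _ ≤ F i + eabs (F i) a := by rw [add_comm]; gcongr; exact le_sup_right
  · simp only
    calc F i ≤ (F i - a) + a := le_tsub_add
      _ ≤ a + eabs (F i) a := by rw [add_comm]; gcongr; exact le_sup_left

lemma ks_tendsto (h : Loc m p C_D C_P lam Ω Ω' R) (ht : TP m p c lam Ω Ω' R f μ G)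
    (hΩ : MeasurableSet Ω)
    (hc : c ≠ ⊤) {g : X → ℝ} (hg : Measurable g)
    (hμ : μ = m.withDensity fun y => ENNReal.ofReal (g y))
    {x : X} (hx : x ∈ Ω') (hxG : x ∈ G)
    (hLL : Tendsto (fun s => LL m g x s) (𝓝[>] 0) (𝓝 0)) {a : ℝ≥0∞} (ha : a ≠ ⊤)
    {V : ℕ → Set X} (hV : ∀ n, MeasurableSet (V n) ∧ V n ⊆ Ω ∧ IsDensityPoint m (V n) x)
    (hlim : Filter.limsup (fun n =>
          Filter.limsup (fun r : ℝ => eabs (ks m p f (V n) x r) a) (𝓝[>] (0:ℝ)))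
        Filter.atTop = 0) :
    Tendsto (fun r : ℝ => ks m p f Ω x r) (𝓝[>] (0:ℝ)) (𝓝 a) := by
  apply tendsto_of_eabs ha
  set L := Filter.limsup (fun r : ℝ => eabs (ks m p f Ω x r) a) (𝓝[>] (0:ℝ)) with hL
  have h1 : ∀ n, L ≤ Filter.limsup (fun r : ℝ => eabs (ks m p f (V n) x r) a) (𝓝[>] (0:ℝ)) := by
    intro n
    have hz := ks_tendsto_zero h ht hc hg hμ (hΩ.diff (hV n).1) diff_subset hx hxG hLL
      (dens_tendsto (hV n).1 h hx (hV n).2.2)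
    apply ENNReal.le_of_forall_pos_le_add
    intro ε hε hfin
    have hε2 : (0 : ℝ≥0∞) < ε / 2 := ENNReal.div_pos (by exact_mod_cast hε.ne') (by simp)
    have e1 := eventually_lt_of_limsup_lt (ENNReal.lt_add_right hfin.ne hε2.ne')
    have e2 := hz.eventually (gt_mem_nhds hε2)
    refine limsup_le_of_le (by isBoundedDefault) ?_
    filter_upwards [e1, e2] with r h1 h2
    rw [ks_split (hV n).1 (hV n).2.1]
    refine (eabs_add_le _ _ _).trans ((add_le_add h1.le h2.le).trans (le_of_eq ?_))
    rw [add_assoc, ENNReal.add_halves]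
  have h2 : L = 0 := by
    refine le_antisymm ?_ zero_le
    rw [← hlim]
    calc L = Filter.limsup (fun _ : ℕ => L) atTop := limsup_const _ |>.symm
      _ ≤ _ := limsup_le_limsup (Eventually.of_forall h1)
  exact tendsto_of_le_liminf_of_limsup_le zero_le h2.le
end

/-! ### Convergence in `L¹` -/

lemma eabs_le_max (a b : ℝ≥0∞) : eabs a b ≤ max a b :=
  sup_le (tsub_le_self.trans (le_max_left _ _)) (tsub_le_self.trans (le_max_right _ _))

lemma eabs_comm' (a b : ℝ≥0∞) : eabs a b = eabs b a := sup_comm _ _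

lemma eabs_le_trunc (a b h : ℝ≥0∞) :
    eabs a b ≤ eabs (min a h) (min b h) + ((a - h) + (b - h)) := by
  have e : ∀ z : ℝ≥0∞, z = min z h + (z - h) := by
    intro z
    rcases le_total z h with hz | hz
    · rw [min_eq_left hz, tsub_eq_zero_of_le hz, add_zero]
    · rw [min_eq_right hz, add_tsub_cancel_of_le hz]
  calc eabs a b = eabs (min a h + (a - h)) (min b h + (b - h)) := by rw [← e a, ← e b]
    _ ≤ eabs (min a h) (min b h + (b - h)) + (a - h) := eabs_add_le _ _ _
    _ = eabs (min b h + (b - h)) (min a h) + (a - h) := by rw [eabs_comm']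
    _ ≤ (eabs (min b h) (min a h) + (b - h)) + (a - h) := by gcongr; exact eabs_add_le _ _ _
    _ = _ := by rw [eabs_comm', add_assoc, add_comm (b - h)]

lemma tendsto_eabs {ι : Type*} {l : Filter ι} {F : ι → ℝ≥0∞} {a : ℝ≥0∞} (ha : a ≠ ⊤)
    (h : Tendsto F l (𝓝 a)) : Tendsto (fun i => eabs (F i) a) l (𝓝 0) := by
  have h1 := ENNReal.Tendsto.sub h (tendsto_const_nhds (x := a)) (Or.inr ha)
  have h2 := ENNReal.Tendsto.sub (tendsto_const_nhds (x := a)) h (Or.inl ha)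
  rw [tsub_self] at h1 h2
  have h3 := h1.sup_nhds h2
  simpa [eabs] using h3

lemma measurable_eabs {u v : X → ℝ≥0∞} (hu : Measurable u) (hv : Measurable v) :
    Measurable fun x => eabs (u x) (v x) :=
  (hu.sub hv).sup (hv.sub hu)

lemma abstract_L1 {M : Measure X} {k : ℝ → X → ℝ≥0∞} (hk : ∀ r, Measurable (k r))
    {e : X → ℝ≥0∞} (he : Measurable e) (he' : ∀ x, e x < ⊤)
    (hlim : ∀ᵐ x ∂M, Tendsto (fun r => k r x) (𝓝[>] 0) (𝓝 (e x)))
    (hsplit : ∀ ε : ℝ≥0∞, 0 < ε → ∃ h : X → ℝ≥0∞, Measurable h ∧ (∀ x, h x ≠ ⊤) ∧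
      ∫⁻ x, h x ∂M ≠ ⊤ ∧ ∀ᶠ r in 𝓝[>] (0 : ℝ), ∫⁻ x, (k r x - h x) ∂M ≤ ε) :
    ∫⁻ x, e x ∂M < ⊤ ∧
      Tendsto (fun r => ∫⁻ x, eabs (k r x) (e x) ∂M) (𝓝[>] 0) (𝓝 0) := by
  have fatou : ∀ (ε : ℝ≥0∞) (h : X → ℝ≥0∞), Measurable h → (∀ x, h x ≠ ⊤) →
      (∀ᶠ r in 𝓝[>] (0 : ℝ), ∫⁻ x, (k r x - h x) ∂M ≤ ε) → ∫⁻ x, (e x - h x) ∂M ≤ ε := by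
    intro ε h hm hh hev
    calc ∫⁻ x, (e x - h x) ∂M
        = ∫⁻ x, liminf (fun r => k r x - h x) (𝓝[>] (0 : ℝ)) ∂M := by
          apply lintegral_congr_ae
          filter_upwards [hlim] with x hx
          exact (ENNReal.Tendsto.sub hx (tendsto_const_nhds (x := h x))
            (Or.inr (hh x))).liminf_eq.symm
      _ ≤ liminf (fun r => ∫⁻ x, (k r x - h x) ∂M) (𝓝[>] (0 : ℝ)) :=
          lintegral_liminf_le' fun r => ((hk r).sub hm).aemeasurable
      _ ≤ limsup (fun r => ∫⁻ x, (k r x - h x) ∂M) (𝓝[>] (0 : ℝ)) := liminf_le_limsup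
      _ ≤ ε := limsup_le_of_le (by isBoundedDefault) hev
  constructor
  · obtain ⟨h, hm, hh, hi, hev⟩ := hsplit 1 one_pos
    calc ∫⁻ x, e x ∂M ≤ ∫⁻ x, (h x + (e x - h x)) ∂M :=
          lintegral_mono fun x => le_add_tsub
      _ = ∫⁻ x, h x ∂M + ∫⁻ x, (e x - h x) ∂M := lintegral_add_left hm _
      _ < ⊤ := ENNReal.add_lt_top.2 ⟨hi.lt_top, (fatou 1 h hm hh hev).trans_lt (by simp)⟩
  · rw [ENNReal.tendsto_nhds_zero]
    intro ε hε
    obtain ⟨h, hm, hh, hi, hev⟩ := hsplit (ε / 2 / 2) (by simp [hε.ne'])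
    have hf := fatou _ h hm hh hev
    have hdct : Tendsto (fun r => ∫⁻ x, eabs (min (k r x) (h x)) (min (e x) (h x)) ∂M)
        (𝓝[>] 0) (𝓝 (∫⁻ _, 0 ∂M)) := by
      refine tendsto_lintegral_filter_of_dominated_convergence h
        (Eventually.of_forall fun r => measurable_eabs ((hk r).min hm) (he.min hm))
        (Eventually.of_forall fun r => ae_of_all _ fun x => (eabs_le_max _ _).trans
          (max_le (min_le_right _ _) (min_le_right _ _))) hi ?_
      filter_upwards [hlim] with x hx
      exact tendsto_eabs (ne_top_of_le_ne_top (he' x).ne (min_le_left _ _))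
        (hx.min tendsto_const_nhds)
    rw [lintegral_zero, ENNReal.tendsto_nhds_zero] at hdct
    filter_upwards [hev, hdct (ε / 2) (by simp [hε.ne'])] with r h1 h2
    calc ∫⁻ x, eabs (k r x) (e x) ∂M
        ≤ ∫⁻ x, (eabs (min (k r x) (h x)) (min (e x) (h x)) +
            ((k r x - h x) + (e x - h x))) ∂M := lintegral_mono fun x => eabs_le_trunc _ _ _
      _ = ∫⁻ x, eabs (min (k r x) (h x)) (min (e x) (h x)) ∂M +
            (∫⁻ x, (k r x - h x) ∂M + ∫⁻ x, (e x - h x) ∂M) := by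
          have hsubm : Measurable fun x => k r x - h x := (hk r).sub hm
          rw [lintegral_add_left (measurable_eabs ((hk r).min hm) (he.min hm)),
            lintegral_add_left hsubm]
      _ ≤ ε / 2 + (ε / 2 / 2 + ε / 2 / 2) := by gcongr
      _ = ε := by rw [ENNReal.add_halves, ENNReal.add_halves]

section
variable [BorelSpace X] [SecondCountableTopology X]

/-- The dominating operator. -/
def TT (m μ : Measure X) (t : ℝ) (x : X) (r : ℝ) : ℝ≥0∞ :=
  HH m μ x t + (m (closedBall x r))⁻¹ * ∫⁻ x' in closedBall x r, HH m μ x' t ∂m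

lemma TT_add (m μ₁ μ₂ : Measure X) [SFinite m] [SFinite μ₁] [SFinite μ₂] (t : ℝ) (x : X) (r : ℝ) :
    TT m (μ₁ + μ₂) t x r = TT m μ₁ t x r + TT m μ₂ t x r := by
  unfold TT
  simp only [HH_add]
  rw [lintegral_add_left (measurable_HH m μ₁ t)]
  ring

lemma measurableSet_setBall (S : Set X) (R : ℝ) : MeasurableSet (setBall S R) :=
  (isClosed_le Metric.continuous_infEDist continuous_const).measurableSet

variable {m : Measure X} [SFinite m] {p : ℝ} {C_D : ℝ≥0} {C_P lam : ℝ} {Ω Ω' : Set X} {R : ℝ}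
  {Y : Type*} [MetricSpace Y] {f : X → Y} {G : Set X} {c : ℝ≥0∞}

lemma lintegral_TT_le (h : Loc m p C_D C_P lam Ω Ω' R) (hΩ' : MeasurableSet Ω')
    (τ : Measure X) [SFinite τ] {r t : ℝ} (hr : 0 < r) (hrR : r ≤ R) (ht : 0 < t) (htR : t ≤ R) :
    ∫⁻ x in Ω', TT m τ t x r ∂m ≤ (4 * C_D + C_D * (4 * C_D)) * τ univ := by
  set S := setBall Ω' R
  set κ := (m.restrict S).withDensity (fun x' => HH m τ x' t) with hκ
  have hS : MeasurableSet S := measurableSet_setBall _ _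
  have h1 : ∫⁻ x in Ω', TT m τ t x r ∂m ≤ ∫⁻ x in Ω', (HH m τ x t + avg m κ x r) ∂m := by
    refine setLIntegral_mono ((measurable_HH m τ t).add (measurable_avg m κ r)) fun x hx => ?_
    unfold TT avg
    have hsub : closedBall x r ⊆ S := fun x' hx' => mem_setBall_near hx hr.le hrR hx'
    rw [hκ, withDensity_apply _ measurableSet_closedBall,
      Measure.restrict_restrict measurableSet_closedBall, inter_eq_self_of_subset_left hsub]
  refine h1.trans ?_
  rw [lintegral_add_left (measurable_HH m τ t)]
  have h2 := h.lintegral_HH_ball hΩ' subset_setBall τ ht htR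
  have h3 : ∫⁻ x in Ω', avg m κ x r ∂m ≤ C_D * κ univ :=
    lintegral_avg_le m κ r Ω' hΩ' h.CD0 ENNReal.coe_ne_top
      fun x hx => (h.dbl x (subset_setBall hx) r hr hrR).2.1
  have h4 : κ univ ≤ 4 * (C_D * τ univ) := by
    rw [hκ, withDensity_apply _ MeasurableSet.univ, Measure.restrict_univ]
    exact h.lintegral_HH_ball hS Subset.rfl τ ht htR
  calc _ ≤ 4 * (C_D * τ univ) + C_D * (4 * (C_D * τ univ)) :=
        add_le_add h2 (h3.trans (by gcongr))
    _ = _ := by ring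

lemma ks_le_TT {μ : Measure X} [SFinite μ] (h : Loc m p C_D C_P lam Ω Ω' R)
    (hΩ : MeasurableSet Ω)
    (ht : TP m p c lam Ω Ω' R f μ G) {x : X} (hx : x ∈ Ω') (hxG : x ∈ G)
    {r : ℝ} (hr : 0 < r) (hrR : 4 * lam * r ≤ R) :
    ks m p f Ω x r ≤ c * TT m μ (4 * lam * r) x r := by
  refine (ks_le h ht hΩ Subset.rfl hx hxG hr hrR).trans ?_
  unfold TT
  gcongr
  · calc _ ≤ HH m μ x (4 * lam * r) * ((m (closedBall x r))⁻¹ * m (closedBall x r)) := by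
          gcongr; exact inter_subset_left
      _ ≤ HH m μ x (4 * lam * r) * 1 := by gcongr; exact ENNReal.inv_mul_le_one _
      _ = _ := mul_one _
  · exact inter_subset_left

lemma TT_le_const {μ : Measure X} {a : ℝ≥0∞} (hμ : ∀ S, MeasurableSet S → μ S ≤ a * m S)
    (t : ℝ) (x : X) (r : ℝ) : TT m μ t x r ≤ 8 * a := by
  have h1 : ∀ x', HH m μ x' t ≤ 4 * a := fun x' =>
    HH_le_of_avg_le fun k => avg_le_const (hμ _ measurableSet_closedBall)
  unfold TT
  calc _ ≤ 4 * a + (m (closedBall x r))⁻¹ * ∫⁻ x' in closedBall x r, 4 * a ∂m := by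
        gcongr
        · exact h1 x
        · exact h1 _
    _ = 4 * a + 4 * a * ((m (closedBall x r))⁻¹ * m (closedBall x r)) := by
        rw [setLIntegral_const]; ring
    _ ≤ 4 * a + 4 * a * 1 := by gcongr; exact ENNReal.inv_mul_le_one _
    _ = _ := by ring

lemma TT_eq_zero {μ : Measure X} {t r : ℝ} (ht : 0 < t) (hr : 0 < r) {x : X}
    (h : μ (closedBall x (r + t)) = 0) : TT m μ t x r = 0 := by
  have h1 : ∀ x' ∈ closedBall x r, HH m μ x' t = 0 := by
    intro x' hx'
    refine le_antisymm ?_ zero_le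
    rw [← mul_zero 4]
    refine HH_le_of_avg_le fun j => ?_
    have hj : t / 2 ^ j ≤ t := div_le_self ht.le (one_le_pow₀ (by norm_num))
    have hsub : closedBall x' (t / 2 ^ j) ⊆ closedBall x (r + t) :=
      closedBall_subset_closedBall' (by have := mem_closedBall.1 hx'; linarith)
    simp [avg, measure_mono_null hsub h]
  unfold TT
  rw [h1 x (mem_closedBall_self hr.le), setLIntegral_congr_fun measurableSet_closedBall h1]
  simp

lemma exists_exhaust (m : Measure X) [IsLocallyFiniteMeasure m] {g : X → ℝ} (hg : Measurable g) :
    ∃ A O : ℕ → Set X, (∀ n, MeasurableSet (A n)) ∧ Monotone A ∧ ⋃ n, A n = univ ∧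
      (∀ n, MeasurableSet (O n) ∧ m (O n) < ⊤) ∧ (∀ n, ∀ x ∈ A n, g x ≤ n) ∧
      ∀ n, ∃ δ : ℝ, 0 < δ ∧ ∀ y, y ∉ O n → Disjoint (closedBall y δ) (A n) := by
  set s := Measure.finiteSpanningSetsInOpen' m with hs
  set O : ℕ → Set X := fun n => ⋃ i ≤ n, s.set i with hO
  have hOo : ∀ n, IsOpen (O n) := fun n => isOpen_iUnion fun i => isOpen_iUnion fun _ => s.set_mem i
  have hOm : Monotone O := fun a b hab => biUnion_mono (fun i hi => le_trans hi hab) fun _ _ => le_rfl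
  set A : ℕ → Set X := fun n =>
    {x | ENNReal.ofReal (1 / (n + 1)) ≤ Metric.infEDist x (O n)ᶜ} ∩ {x | g x ≤ n} with hA
  refine ⟨A, O, fun n => ?_, ?_, ?_, fun n => ⟨(hOo n).measurableSet, ?_⟩, fun n x hx => hx.2,
    fun n => ⟨1 / (n + 1) / 2, by positivity, fun y hy => ?_⟩⟩
  · exact (isClosed_le continuous_const Metric.continuous_infEDist).measurableSet.inter
      (measurableSet_le hg measurable_const)
  · intro a b hab x hx
    have hab' : (a : ℝ) ≤ b := by exact_mod_cast hab
    refine ⟨?_, hx.2.trans hab'⟩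
    calc ENNReal.ofReal (1 / (b + 1)) ≤ ENNReal.ofReal (1 / (a + 1)) := by
          apply ENNReal.ofReal_le_ofReal
          apply one_div_le_one_div_of_le (by positivity)
          linarith
      _ ≤ Metric.infEDist x (O a)ᶜ := hx.1
      _ ≤ _ := Metric.infEDist_anti (compl_subset_compl.2 (hOm hab))
  · rw [eq_univ_iff_forall]
    intro x
    have hx : x ∈ ⋃ i, s.set i := by rw [s.spanning]; trivial
    obtain ⟨i, hi⟩ := mem_iUnion.1 hx
    have hxO : x ∈ O i := mem_iUnion₂.2 ⟨i, le_rfl, hi⟩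
    have hpos : 0 < Metric.infEDist x (O i)ᶜ := by
      rw [Metric.infEDist_pos_iff_notMem_closure, (hOo i).isClosed_compl.closure_eq]
      exact fun h => h hxO
    have h0 : Tendsto (fun n : ℕ => ENNReal.ofReal (1 / ((n : ℝ) + 1))) atTop (𝓝 0) := by
      rw [← ENNReal.ofReal_zero]
      exact ENNReal.tendsto_ofReal tendsto_one_div_add_atTop_nhds_zero_nat
    obtain ⟨N, hN⟩ := exists_nat_ge (g x)
    obtain ⟨n, hn1, hn2, hn3⟩ := ((h0.eventually (gt_mem_nhds hpos)).and
      ((eventually_ge_atTop i).and (eventually_ge_atTop N))).exists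
    refine mem_iUnion.2 ⟨n, hn1.le.trans ?_, hN.trans (by exact_mod_cast hn3)⟩
    exact Metric.infEDist_anti (compl_subset_compl.2 (hOm hn2))
  · exact (measure_biUnion_lt_top (finite_le_nat n) fun i _ => s.finite i)
  · rw [Set.disjoint_left]
    rintro z hz ⟨hz1, -⟩
    have h1 : ENNReal.ofReal (1 / ((n : ℝ) + 1)) ≤ ENNReal.ofReal (1 / (n + 1) / 2) := by
      refine hz1.trans ((Metric.infEDist_le_edist_of_mem (show y ∈ (O n)ᶜ from hy)).trans ?_)
      rw [edist_dist]
      exact ENNReal.ofReal_le_ofReal hz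
    rw [ENNReal.ofReal_le_ofReal_iff (by positivity)] at h1
    have : (0 : ℝ) < 1 / (n + 1) := by positivity
    linarith

lemma measurable_ks (m : Measure X) [SFinite m] (p : ℝ) {F : X → Y} (hF : StronglyMeasurable F)
    (Ω : Set X) (r : ℝ) : Measurable fun x => ks m p F Ω x r := by
  unfold ks
  refine (measurable_measure_closedBall m r).inv.mul ?_
  have hset : MeasurableSet {q : X × X | dist q.2 q.1 ≤ r} :=
    (isClosed_le (by fun_prop) continuous_const).measurableSet
  have hK : Measurable fun q : X × X =>
      {q : X × X | dist q.2 q.1 ≤ r}.indicator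
        (fun q => edist (F q.1) (F q.2) ^ p / ENNReal.ofReal r ^ p) q := by
    refine Measurable.indicator ?_ hset
    exact ((((hF.comp_measurable measurable_fst).edist
      (hF.comp_measurable measurable_snd)).measurable).pow_const p).div_const _
  have := Measurable.lintegral_prod_right' (ν := m.restrict Ω) hK
  convert this using 2 with x
  rw [← Measure.restrict_restrict measurableSet_closedBall,
    ← lintegral_indicator measurableSet_closedBall]
  rfl

lemma L1_conv [IsLocallyFiniteMeasure m] {μ : Measure X} [IsFiniteMeasure μ]
    (h : Loc m p C_D C_P lam Ω Ω' R)
    (hΩ : MeasurableSet Ω) (hΩ' : MeasurableSet Ω') (hsub : Ω' ⊆ Ω)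
    (ht : TP m p c lam Ω Ω' R f μ G) (hc : c ≠ ⊤) {g : X → ℝ} (hg : Measurable g)
    (hμ : μ = m.withDensity fun y => ENNReal.ofReal (g y))
    (hf : AEStronglyMeasurable f (m.restrict Ω))
    {e : X → ℝ≥0∞} (he : Measurable e) (he' : ∀ x, e x < ⊤)
    (hlim : ∀ᵐ x ∂m.restrict Ω', Tendsto (fun r => ks m p f Ω x r) (𝓝[>] 0) (𝓝 (e x))) :
    ∫⁻ x in Ω', e x ∂m < ⊤ ∧
      Tendsto (fun r => ∫⁻ x in Ω', eabs (ks m p f Ω x r) (e x) ∂m) (𝓝[>] 0) (𝓝 0) := by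
  set F := hf.mk f with hF
  have hFm : StronglyMeasurable F := hf.stronglyMeasurable_mk
  have hfF : f =ᵐ[m.restrict Ω] F := hf.ae_eq_mk
  have hks : ∀ᵐ x ∂m.restrict Ω', ∀ r, ks m p f Ω x r = ks m p F Ω x r := by
    filter_upwards [ae_restrict_of_ae_restrict_of_subset hsub hfF] with x hx r
    unfold ks
    congr 1
    apply lintegral_congr_ae
    filter_upwards [ae_restrict_of_ae_restrict_of_subset inter_subset_right hfF] with y hy
    rw [hx, hy]
  have hcongr : ∀ r, ∫⁻ x in Ω', eabs (ks m p f Ω x r) (e x) ∂m =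
      ∫⁻ x in Ω', eabs (ks m p F Ω x r) (e x) ∂m := by
    intro r
    apply lintegral_congr_ae
    filter_upwards [hks] with x hx
    rw [hx]
  simp only [hcongr]
  have hlam := h.hlam
  have hR := h.hR
  set K : ℝ≥0∞ := 4 * C_D + C_D * (4 * C_D) with hK
  have hKt : K ≠ ⊤ := by simp [hK, ENNReal.mul_eq_top]
  obtain ⟨A, O, hAm, hAmono, hAu, hO, hAg, hAδ⟩ := exists_exhaust m hg
  refine abstract_L1 (k := fun r x => ks m p F Ω x r) (fun r => measurable_ks m p hFm Ω r)
    he he' ?_ ?_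
  · filter_upwards [hlim, hks] with x hx hx2
    exact hx.congr hx2
  · intro ε hε
    have hA0 : Tendsto (fun n => c * (K * μ (A n)ᶜ)) atTop (𝓝 0) := by
      have h1 := tendsto_measure_iInter_atTop (μ := μ) (s := fun n => (A n)ᶜ)
        (fun n => (hAm n).compl.nullMeasurableSet)
        (fun a b hab => compl_subset_compl.2 (hAmono hab)) ⟨0, measure_ne_top _ _⟩
      rw [← compl_iUnion, hAu, compl_univ, measure_empty] at h1
      have h2 := ENNReal.Tendsto.const_mul (ENNReal.Tendsto.const_mul h1 (Or.inr hKt)) (Or.inr hc)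
      simpa using h2
    obtain ⟨n, hn⟩ := (hA0.eventually (gt_mem_nhds hε)).exists
    obtain ⟨δ, hδ, hdisj⟩ := hAδ n
    have hcn : c * (8 * (n : ℝ≥0∞)) ≠ ⊤ := ENNReal.mul_ne_top hc (ENNReal.mul_ne_top (by simp) (by simp))
    refine ⟨(O n).indicator fun _ => c * (8 * (n : ℝ≥0∞)), measurable_const.indicator (hO n).1,
      ?_, ?_, ?_⟩
    · intro x
      by_cases hx : x ∈ O n <;> simp only [hx, indicator_of_mem, indicator_of_notMem,
        not_false_eq_true]
      · exact hcn
      · simp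
    · rw [lintegral_indicator (hO n).1, setLIntegral_const]
      refine ENNReal.mul_ne_top hcn (ne_top_of_le_ne_top (hO n).2.ne ?_)
      exact Measure.restrict_apply_le _ _
    · set μ₁ := μ.restrict (A n) with hμ₁
      set μ₂ := μ.restrict (A n)ᶜ with hμ₂
      have hsum : μ = μ₁ + μ₂ := (Measure.restrict_add_restrict_compl (hAm n)).symm
      have hμ₁le : ∀ S, MeasurableSet S → μ₁ S ≤ n * m S := by
        intro S hS
        rw [hμ₁, Measure.restrict_apply hS, hμ, withDensity_apply _ (hS.inter (hAm n))]
        calc ∫⁻ y in S ∩ A n, ENNReal.ofReal (g y) ∂m ≤ ∫⁻ y in S ∩ A n, (n : ℝ≥0∞) ∂m := by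
              refine setLIntegral_mono measurable_const fun y hy => ?_
              rw [← ENNReal.ofReal_natCast]
              exact ENNReal.ofReal_le_ofReal (hAg n y hy.2)
          _ = n * m (S ∩ A n) := setLIntegral_const _ _
          _ ≤ n * m S := by gcongr; exact inter_subset_left
      filter_upwards [Ioc_mem_nhdsGT (by positivity : 0 < R / (4 * lam)),
        Ioc_mem_nhdsGT (by positivity : 0 < δ / (1 + 4 * lam))] with r hr1 hr2
      have hr0 := hr1.1
      have hrR : 4 * lam * r ≤ R := by
        have := hr1.2
        rw [le_div_iff₀ (by positivity)] at this
        linarith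
      have hrδ : r + 4 * lam * r ≤ δ := by
        have := hr2.2
        rw [le_div_iff₀ (by positivity)] at this
        linarith
      have hrR' : r ≤ R := by nlinarith
      have hbound : ∀ᵐ x ∂m.restrict Ω', ks m p F Ω x r -
          (O n).indicator (fun _ => c * (8 * (n : ℝ≥0∞))) x ≤ c * TT m μ₂ (4 * lam * r) x r := by
        filter_upwards [hks, ae_restrict_of_ae_restrict_of_subset hsub ht.ae,
          ae_restrict_mem hΩ'] with x hx1 hxG hxΩ'
        rw [← hx1, tsub_le_iff_right]
        refine (ks_le_TT h hΩ ht hxΩ' hxG hr0 hrR).trans ?_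
        rw [hsum, TT_add, mul_add, add_comm]
        gcongr
        by_cases hxO : x ∈ O n
        · rw [indicator_of_mem hxO]
          gcongr
          exact TT_le_const hμ₁le _ _ _
        · rw [TT_eq_zero (by positivity) hr0, mul_zero]
          · exact zero_le
          · rw [hμ₁, Measure.restrict_apply measurableSet_closedBall]
            have := (hdisj x hxO).mono_left (closedBall_subset_closedBall hrδ)
            rw [this.inter_eq, measure_empty]
      calc _ ≤ ∫⁻ x in Ω', c * TT m μ₂ (4 * lam * r) x r ∂m := lintegral_mono_ae hbound
        _ = c * ∫⁻ x in Ω', TT m μ₂ (4 * lam * r) x r ∂m := lintegral_const_mul' _ _ hc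
        _ ≤ c * (K * μ₂ univ) := by
            gcongr
            exact lintegral_TT_le h hΩ' μ₂ hr0 hrR' (by positivity) hrR
        _ = c * (K * μ (A n)ᶜ) := by rw [hμ₂, Measure.restrict_apply_univ]
        _ ≤ ε := hn.le
end

theorem statement4
    {X : Type*} [MetricSpace X] [TopologicalSpace.SeparableSpace X] [ConnectedSpace X]
    [Nontrivial X] [MeasurableSpace X] [BorelSpace X]
    (hloc : ∀ x : X, ∃ r > 0, IsComplete (closedBall x r))
    (m : Measure X) [IsLocallyFiniteMeasure m] (hm : m ≠ 0)
    (p : ℝ) (hp : 1 ≤ p)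
    (C_D : ℝ≥0) (hD : InternallyDoubling m C_D)
    (C_P lam : ℝ) (hP : InternalPoincare m p C_P lam)
    (Ω : Set X) (hΩ : IsOpen Ω)
    (Y : Type*) [MetricSpace Y] (f : X → Y)
    (hf : MemLpLocY m p Ω f) (hf' : MemSobolevClass m p Ω f)
    (e : X → ℝ≥0∞) (he : Measurable e) (he' : ∀ x, e x < ⊤)
    (happrox : ∀ᵐ x ∂m.restrict Ω, ∃ V : ℕ → Set X,
      (∀ n, MeasurableSet (V n) ∧ V n ⊆ Ω ∧ IsDensityPoint m (V n) x) ∧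
      Filter.limsup (fun n =>
          Filter.limsup (fun r : ℝ => eabs (ks m p f (V n) x r) (e x)) (𝓝[>] (0:ℝ)))
        Filter.atTop = 0) :
    ∀ Ω' : Set X, IsOpen Ω' → WellInside Ω' Ω →
      (∫⁻ x in Ω', e x ∂m) < ⊤ ∧
      Filter.Tendsto (fun r : ℝ => ∫⁻ x in Ω', eabs (ks m p f Ω x r) (e x) ∂m)
        (𝓝[>] (0:ℝ)) (𝓝 0) ∧
      ∀ᵐ x ∂m.restrict Ω',
        Filter.Tendsto (fun r : ℝ => ks m p f Ω x r) (𝓝[>] (0:ℝ)) (𝓝 (e x)) := by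
  have hsc : SecondCountableTopology X := UniformSpace.secondCountable_of_separable X
  intro Ω' hΩ'o hW
  obtain ⟨R, hR, hd, hpo, hcpt⟩ := exists_good_radius hD hP hW
  have hL : Loc m p C_D C_P lam Ω Ω' R := ⟨hp, hD.1, hP.1, hP.2.1, hR, hd, hpo, hcpt⟩
  obtain ⟨μ, hμfin, hac, G, hG, htwo⟩ := exists_two_point hloc hD hΩ.measurableSet hL hf'
  have hT : TP m p (c0 p C_D C_P) lam Ω Ω' R f μ G := ⟨hG, htwo⟩
  have hc := c0_ne_top hp C_D C_P
  have hgm : Measurable fun x => (μ.rnDeriv m x).toReal :=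
    (Measure.measurable_rnDeriv μ m).ennreal_toReal
  have hμ : μ = m.withDensity fun y => ENNReal.ofReal (μ.rnDeriv m y).toReal := by
    conv_lhs => rw [← Measure.withDensity_rnDeriv_eq μ m hac]
    apply withDensity_congr_ae
    filter_upwards [Measure.rnDeriv_lt_top μ m] with x hx
    exact (ENNReal.ofReal_toReal hx.ne).symm
  have hli : LocallyIntegrable (fun x => (μ.rnDeriv m x).toReal) m :=
    Measure.integrable_toReal_rnDeriv.locallyIntegrable
  have hsub : Ω' ⊆ Ω := hW.1
  have hlim : ∀ᵐ x ∂m.restrict Ω',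
      Tendsto (fun r : ℝ => ks m p f Ω x r) (𝓝[>] (0:ℝ)) (𝓝 (e x)) := by
    filter_upwards [ae_restrict_of_ae_restrict_of_subset hsub happrox,
      ae_restrict_of_ae_restrict_of_subset hsub hG,
      ae_restrict_of_ae (ae_LL_tendsto hloc hD hli),
      ae_restrict_mem hΩ'o.measurableSet] with x hx hxG hxL hxΩ
    obtain ⟨V, hV, hVlim⟩ := hx
    exact ks_tendsto hL hT hΩ.measurableSet hc hgm hμ hxΩ hxG hxL (he' x).ne hV hVlim
  obtain ⟨h1, h2⟩ := L1_conv hL hΩ.measurableSet hΩ'o.measurableSet hsub hT hc hgm hμ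
    (hf'.1.aestronglyMeasurable hΩ.measurableSet) he he' hlim
  exact ⟨h1, h2, hlim⟩

end BBM
end
end

section
/- Suppose X is strongly rectifiable, with dimensional decomposition given by the Borel function Dim : X → ℕ. Then for m-a.e. x ∈ X: lim_{r↘0} m(B(x,hr))/m(B(x,r)) = h^{Dim(x)} for every h > 0. -/
open MeasureTheory Filter Metric Set Topology
open scoped ENNReal NNReal

noncomputable section

namespace BBM

variable {X : Type*} [MetricSpace X]

variable [MeasurableSpace X]

theorem density_zero {Z : Type*} [MetricSpace Z] [TopologicalSpace.SeparableSpace Z]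
    [MeasurableSpace Z] [BorelSpace Z] (m ν : Measure Z) [IsLocallyFiniteMeasure ν]
    (U : Set Z) (hU : ν U = 0) (d : ℕ) (C : ℝ≥0∞) (hC : C ≠ ⊤)
    (hup : ∀ x ∈ U, ∀ r : ℝ, 0 < r → m (U ∩ closedBall x r) ≤ C * ENNReal.ofReal r ^ d)
    (t : ℝ≥0∞) (ht0 : t ≠ 0) (ht : t ≠ ⊤) :
    m {x ∈ U | ∃ᶠ r in 𝓝[>] (0:ℝ), t * ENNReal.ofReal r ^ d < ν (closedBall x r)} = 0 := by
  haveI : SecondCountableTopology Z := UniformSpace.secondCountable_of_separable Z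
  set A := {x ∈ U | ∃ᶠ r in 𝓝[>] (0:ℝ), t * ENNReal.ofReal r ^ d < ν (closedBall x r)} with hA
  set K : ℝ≥0∞ := C * ENNReal.ofReal 5 ^ d * t⁻¹ with hK
  have hKtop : K ≠ ⊤ := by
    refine ENNReal.mul_ne_top (ENNReal.mul_ne_top hC (ENNReal.pow_ne_top ENNReal.ofReal_ne_top)) ?_
    simpa using ht0
  have key : ∀ O : Set Z, IsOpen O → U ⊆ O → m A ≤ K * ν O := by
    intro O hO hUO
    have hex : ∀ x : Z, ∃ r : ℝ, x ∈ A → 0 < r ∧ r ≤ 1 ∧ closedBall x r ⊆ O ∧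
        t * ENNReal.ofReal r ^ d < ν (closedBall x r) := by
      intro x
      by_cases hx : x ∈ A
      · obtain ⟨δ, hδ, hδO⟩ := Metric.isOpen_iff.1 hO x (hUO hx.1)
        have h1 : ∀ᶠ r in 𝓝[>] (0:ℝ), r ∈ Ioo (0:ℝ) (min δ 1) :=
          Ioo_mem_nhdsGT (lt_min hδ one_pos)
        obtain ⟨r, hr, hr'⟩ := (hx.2.and_eventually h1).exists
        refine ⟨r, fun _ => ⟨hr'.1, (hr'.2.trans_le (min_le_right _ _)).le, ?_, hr⟩⟩
        exact (closedBall_subset_ball (hr'.2.trans_le (min_le_left _ _))).trans hδO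
      · exact ⟨0, fun h => absurd h hx⟩
    choose R hR using hex
    obtain ⟨u, huA, hdisj, hcov⟩ := Vitali.exists_disjoint_subfamily_covering_enlargement_closedBall
      A (fun x => x) R 1 (fun a ha => (hR a ha).2.1) 5 (by norm_num)
    have hucount : u.Countable := by
      refine hdisj.countable_of_nonempty_interior ?_
      intro a ha
      exact ⟨a, ball_subset_interior_closedBall (mem_ball_self (hR a (huA ha)).1)⟩
    have hsub : A ⊆ ⋃ b ∈ u, U ∩ closedBall b (5 * R b) := by
      intro a ha
      obtain ⟨b, hb, hab⟩ := hcov a ha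
      refine mem_iUnion₂.2 ⟨b, hb, ha.1, hab (mem_closedBall_self (hR a ha).1.le)⟩
    haveI := hucount.to_subtype
    calc m A ≤ m (⋃ b ∈ u, U ∩ closedBall b (5 * R b)) := measure_mono hsub
      _ ≤ ∑' b : u, m (U ∩ closedBall (b : Z) (5 * R b)) := measure_biUnion_le _ hucount _
      _ ≤ ∑' b : u, K * ν (closedBall (b : Z) (R b)) := by
          refine ENNReal.tsum_le_tsum fun b => ?_
          obtain ⟨hb0, -, -, hb⟩ := hR b (huA b.2)
          refine (hup b (huA b.2).1 _ (by positivity)).trans ?_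
          rw [ENNReal.ofReal_mul (by norm_num), mul_pow]
          calc C * (ENNReal.ofReal 5 ^ d * ENNReal.ofReal (R b) ^ d)
              = K * (t * ENNReal.ofReal (R b) ^ d) := by
                rw [hK]
                calc _ = C * ENNReal.ofReal 5 ^ d * (t⁻¹ * t) * ENNReal.ofReal (R b) ^ d := by
                      rw [ENNReal.inv_mul_cancel ht0 ht]; ring
                  _ = _ := by ring
            _ ≤ _ := by gcongr
      _ = K * ∑' b : u, ν (closedBall (b : Z) (R b)) := ENNReal.tsum_mul_left
      _ = K * ν (⋃ b ∈ u, closedBall b (R b)) := by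
          rw [measure_biUnion hucount hdisj (fun b _ => isClosed_closedBall.measurableSet)]
      _ ≤ K * ν O := by
          gcongr
          exact iUnion₂_subset fun b hb => (hR b (huA hb)).2.2.1
  by_contra hne
  have hpos : 0 < m A / K := ENNReal.div_pos hne hKtop
  rw [← hU] at hpos
  obtain ⟨O, hUO, hO, hlt⟩ := U.exists_isOpen_lt_of_lt _ hpos
  have h1 := key O hO hUO
  have h2 := ENNReal.mul_lt_of_lt_div' hlt
  exact absurd h1 (not_le.2 h2)

theorem chart_bounds {Z : Type*} [MetricSpace Z] [TopologicalSpace.SeparableSpace Z]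
    [MeasurableSpace Z] [BorelSpace Z] (m : Measure Z) [IsLocallyFiniteMeasure m]
    (ε : ℝ) (hε : 0 < ε) (d : ℕ) (U : Set Z) (hUm : MeasurableSet U)
    (ψ : Z → EuclideanSpace ℝ (Fin d)) (c : ℝ) (hc : 0 < c)
    (θ : EuclideanSpace ℝ (Fin d) → ℝ) (hθ : ∀ v, θ v ∈ Set.Icc (1 + ε)⁻¹ (1 + ε))
    (hbi : ∀ x ∈ U, ∀ y ∈ U,
      dist x y ≤ (1 + ε) * dist (ψ x) (ψ y) ∧ dist (ψ x) (ψ y) ≤ (1 + ε) * dist x y)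
    (hpush : ∀ A : Set (EuclideanSpace ℝ (Fin d)), MeasurableSet A →
      m (U ∩ ψ ⁻¹' A) = ∫⁻ v in A ∩ ψ '' U, ENNReal.ofReal (c * θ v)) :
    m {x ∈ U | ¬ ∃ κ : ℝ, 0 < κ ∧ ∀ᶠ r in 𝓝[>] (0:ℝ),
      ENNReal.ofReal (κ * r ^ d / (1 + ε) ^ (d + 2)) ≤ m (closedBall x r) ∧
      m (closedBall x r) ≤ ENNReal.ofReal ((1 + ε) ^ (d + 2) * (κ * r ^ d))} = 0 := by
  have h1ε : 0 < 1 + ε := by linarith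
  set S := ψ '' U with hS
  have hlow : ∀ A, MeasurableSet A →
      ENNReal.ofReal (c * (1 + ε)⁻¹) * volume (A ∩ S) ≤ m (U ∩ ψ ⁻¹' A) := by
    intro A hA
    rw [hpush A hA, ← setLIntegral_const]
    refine lintegral_mono fun v => ENNReal.ofReal_le_ofReal ?_
    exact mul_le_mul_of_nonneg_left (hθ v).1 hc.le
  have hupp : ∀ A, MeasurableSet A →
      m (U ∩ ψ ⁻¹' A) ≤ ENNReal.ofReal (c * (1 + ε)) * volume (A ∩ S) := by
    intro A hA
    rw [hpush A hA, ← setLIntegral_const]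
    refine lintegral_mono fun v => ENNReal.ofReal_le_ofReal ?_
    exact mul_le_mul_of_nonneg_left (hθ v).2 hc.le
  set w : ℝ := (volume (closedBall (0 : EuclideanSpace ℝ (Fin d)) 1)).toReal with hw
  have hwfin : volume (closedBall (0 : EuclideanSpace ℝ (Fin d)) 1) ≠ ⊤ :=
    measure_closedBall_lt_top.ne
  have hw0 : 0 < w :=
    ENNReal.toReal_pos (measure_closedBall_pos volume _ one_pos).ne' hwfin
  have hvol : ∀ (v : EuclideanSpace ℝ (Fin d)) (r : ℝ), 0 ≤ r →
      volume (closedBall v r) = ENNReal.ofReal (r ^ d * w) := by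
    intro v r hr
    rw [Measure.addHaar_closedBall' _ _ hr, ENNReal.ofReal_mul (by positivity), hw,
      ENNReal.ofReal_toReal hwfin]
    simp
  have hU1 : ∀ x ∈ U, ∀ r : ℝ, 0 < r →
      m (U ∩ closedBall x r) ≤ ENNReal.ofReal ((1 + ε) ^ (d + 1) * (c * w) * r ^ d) := by
    intro x hx r hr
    calc m (U ∩ closedBall x r) ≤ m (U ∩ ψ ⁻¹' (closedBall (ψ x) ((1 + ε) * r))) := by
          refine measure_mono fun y hy => ⟨hy.1, ?_⟩
          have h1 := (hbi y hy.1 x hx).2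
          have h2 : dist y x ≤ r := hy.2
          exact h1.trans (mul_le_mul_of_nonneg_left h2 h1ε.le)
      _ ≤ ENNReal.ofReal (c * (1 + ε)) * volume (closedBall (ψ x) ((1 + ε) * r) ∩ S) :=
          hupp _ isClosed_closedBall.measurableSet
      _ ≤ ENNReal.ofReal (c * (1 + ε)) * volume (closedBall (ψ x) ((1 + ε) * r)) := by
          gcongr; exact inter_subset_left
      _ = _ := by
          rw [hvol _ _ (by positivity), ← ENNReal.ofReal_mul (by positivity)]
          congr 1; rw [mul_pow]; ring
  -- density of the complement
  set t : ℝ := ((1 + ε) ^ (d + 2) - (1 + ε) ^ (d + 1)) * (c * w) with ht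
  have ht0 : 0 < t := by
    have : (1 + ε) ^ (d + 1) < (1 + ε) ^ (d + 2) :=
      pow_lt_pow_right₀ (by linarith) (by omega)
    have := sub_pos.2 this
    positivity
  haveI : SecondCountableTopology Z := UniformSpace.secondCountable_of_separable Z
  have hnull1 := density_zero m (m.restrict Uᶜ) U
    (by rw [Measure.restrict_apply hUm]; simp) d
    (ENNReal.ofReal ((1 + ε) ^ (d + 1) * (c * w))) ENNReal.ofReal_ne_top
    (by
      intro x hx r hr
      rw [← ENNReal.ofReal_pow hr.le, ← ENNReal.ofReal_mul (by positivity)]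
      exact hU1 x hx r hr)
    (ENNReal.ofReal t) (by simpa using ht0) ENNReal.ofReal_ne_top
  -- Lebesgue density points of the image
  have hdens := Besicovitch.ae_tendsto_measure_inter_div
    (volume : Measure (EuclideanSpace ℝ (Fin d))) S
  obtain ⟨N, hNsub, hNm, hN0⟩ := exists_measurable_superset_of_null (mem_ae_iff.1 hdens)
  have hnull2 : m (U ∩ ψ ⁻¹' N) = 0 := by
    refine le_antisymm ((hupp N hNm).trans ?_) bot_le
    rw [Measure.restrict_apply hNm] at hN0
    simp [hN0]
  refine measure_mono_null ?_ (measure_union_null hnull1 hnull2)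
  rintro x ⟨hxU, hx⟩
  by_contra hcon
  rw [mem_union, not_or] at hcon
  obtain ⟨hc1, hc2⟩ := hcon
  apply hx
  have hc1' : ∀ᶠ r in 𝓝[>] (0:ℝ),
      (m.restrict Uᶜ) (closedBall x r) ≤ ENNReal.ofReal t * ENNReal.ofReal r ^ d := by
    by_contra hf
    apply hc1
    refine ⟨hxU, ?_⟩
    rw [Filter.not_eventually] at hf
    exact hf.mono fun r hr => not_le.1 hr
  have hc2' : Tendsto (fun r => volume (S ∩ closedBall (ψ x) r) / volume (closedBall (ψ x) r))
      (𝓝[>] 0) (𝓝 1) := by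
    by_contra hf
    exact hc2 ⟨hxU, hNsub hf⟩
  have hlt1 : ENNReal.ofReal (1 + ε)⁻¹ < 1 := by
    rw [← ENNReal.ofReal_one]
    exact (ENNReal.ofReal_lt_ofReal_iff one_pos).2 (inv_lt_one_of_one_lt₀ (by linarith))
  have hscale : Tendsto (fun r : ℝ => r * (1 + ε)⁻¹) (𝓝[>] 0) (𝓝[>] 0) := by
    refine tendsto_nhdsWithin_iff.2 ⟨?_, ?_⟩
    · have : Tendsto (fun r : ℝ => r * (1 + ε)⁻¹) (𝓝 0) (𝓝 (0 * (1 + ε)⁻¹)) :=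
        tendsto_id.mul_const _
      rw [zero_mul] at this
      exact this.mono_left nhdsWithin_le_nhds
    · filter_upwards [self_mem_nhdsWithin] with r hr
      exact mul_pos hr (inv_pos.2 h1ε)
  have hev := hscale.eventually (hc2'.eventually (lt_mem_nhds hlt1))
  refine ⟨c * w, by positivity, ?_⟩
  filter_upwards [hc1', hev, self_mem_nhdsWithin] with r hr1 hr2 hr0
  have hr0 : 0 < r := hr0
  constructor
  · have hρ : 0 < r * (1 + ε)⁻¹ := mul_pos hr0 (inv_pos.2 h1ε)
    have h3 := ENNReal.mul_lt_of_lt_div hr2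
    rw [hvol _ _ hρ.le, ← ENNReal.ofReal_mul (by positivity)] at h3
    calc ENNReal.ofReal (c * w * r ^ d / (1 + ε) ^ (d + 2))
        = ENNReal.ofReal (c * (1 + ε)⁻¹) *
          ENNReal.ofReal ((1 + ε)⁻¹ * ((r * (1 + ε)⁻¹) ^ d * w)) := by
          rw [← ENNReal.ofReal_mul (by positivity)]
          congr 1
          rw [mul_pow, inv_pow]
          field_simp
          try ring
      _ ≤ ENNReal.ofReal (c * (1 + ε)⁻¹) * volume (closedBall (ψ x) (r * (1 + ε)⁻¹) ∩ S) := by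
          rw [inter_comm]; gcongr
      _ ≤ m (U ∩ ψ ⁻¹' (closedBall (ψ x) (r * (1 + ε)⁻¹))) :=
          hlow _ isClosed_closedBall.measurableSet
      _ ≤ m (closedBall x r) := by
          refine measure_mono fun y hy => ?_
          have h1 := (hbi y hy.1 x hxU).1
          have h2 : dist (ψ y) (ψ x) ≤ r * (1 + ε)⁻¹ := hy.2
          refine h1.trans ((mul_le_mul_of_nonneg_left h2 h1ε.le).trans_eq ?_)
          field_simp
  · rw [Measure.restrict_apply isClosed_closedBall.measurableSet] at hr1
    calc m (closedBall x r) ≤ m (U ∩ closedBall x r) + m (closedBall x r ∩ Uᶜ) := by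
          rw [inter_comm U]
          exact measure_le_inter_add_diff _ _ _
      _ ≤ ENNReal.ofReal ((1 + ε) ^ (d + 1) * (c * w) * r ^ d) +
          ENNReal.ofReal t * ENNReal.ofReal r ^ d := add_le_add (hU1 x hxU r hr0) hr1
      _ = _ := by
          rw [← ENNReal.ofReal_pow hr0.le, ← ENNReal.ofReal_mul ht0.le,
            ← ENNReal.ofReal_add (by positivity) (by positivity)]
          congr 1
          rw [ht]; ring

theorem ratio_bounds {Z : Type*} [MetricSpace Z] [MeasurableSpace Z] (m : Measure Z) (x : Z)
    (L κ : ℝ) (hL : 0 < L) (hκ : 0 < κ) (d : ℕ)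
    (H : ∀ᶠ r in 𝓝[>] (0:ℝ), ENNReal.ofReal (κ * r ^ d / L) ≤ m (closedBall x r) ∧
      m (closedBall x r) ≤ ENNReal.ofReal (L * (κ * r ^ d))) (h : ℝ) (hh : 0 < h) :
    ∀ᶠ r in 𝓝[>] (0:ℝ),
      ENNReal.ofReal (h ^ d / L ^ 2) ≤ m (closedBall x (h * r)) / m (closedBall x r) ∧
      m (closedBall x (h * r)) / m (closedBall x r) ≤ ENNReal.ofReal (L ^ 2 * h ^ d) := by
  have hscale : Tendsto (fun r : ℝ => h * r) (𝓝[>] 0) (𝓝[>] 0) := by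
    refine tendsto_nhdsWithin_iff.2 ⟨?_, ?_⟩
    · have : Tendsto (fun r : ℝ => h * r) (𝓝 0) (𝓝 (h * 0)) := tendsto_id.const_mul _
      rw [mul_zero] at this
      exact this.mono_left nhdsWithin_le_nhds
    · filter_upwards [self_mem_nhdsWithin] with r hr
      exact mul_pos hh hr
  filter_upwards [H, hscale.eventually H, self_mem_nhdsWithin] with r h1 h2 hr0
  have hr0 : 0 < r := hr0
  constructor
  · calc ENNReal.ofReal (h ^ d / L ^ 2)
        = ENNReal.ofReal (κ * (h * r) ^ d / L) / ENNReal.ofReal (L * (κ * r ^ d)) := by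
          rw [← ENNReal.ofReal_div_of_pos (by positivity)]
          congr 1
          rw [mul_pow]; field_simp
      _ ≤ _ := ENNReal.div_le_div h2.1 h1.2
  · calc m (closedBall x (h * r)) / m (closedBall x r)
        ≤ ENNReal.ofReal (L * (κ * (h * r) ^ d)) / ENNReal.ofReal (κ * r ^ d / L) :=
          ENNReal.div_le_div h2.2 h1.1
      _ = _ := by
          rw [← ENNReal.ofReal_div_of_pos (by positivity)]
          congr 1
          rw [mul_pow]; field_simp

theorem statement17
    {X : Type*} [MetricSpace X] [TopologicalSpace.SeparableSpace X] [ConnectedSpace X]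
    [Nontrivial X] [MeasurableSpace X] [BorelSpace X]
    (hloc : ∀ x : X, ∃ r > 0, IsComplete (closedBall x r))
    (m : Measure X) [IsLocallyFiniteMeasure m] (hm : m ≠ 0)
    (hrect : StronglyRectifiable m)
    (Dim : X → ℕ) (hDim : IsDimensionFunction m Dim) :
    ∀ᵐ x ∂m, ∀ h : ℝ, 0 < h →
      Filter.Tendsto (fun r : ℝ => m (closedBall x (h * r)) / m (closedBall x r))
        (𝓝[>] (0:ℝ)) (𝓝 (ENNReal.ofReal h ^ (Dim x))) := by
  have hstep : ∀ ε ∈ Ioo (0:ℝ) 1, ∀ᵐ x ∂m, ∃ κ : ℝ, 0 < κ ∧ ∀ᶠ r in 𝓝[>] (0:ℝ),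
      ENNReal.ofReal (κ * r ^ (Dim x) / (1 + ε) ^ (Dim x + 2)) ≤ m (closedBall x r) ∧
      m (closedBall x r) ≤ ENNReal.ofReal ((1 + ε) ^ (Dim x + 2) * (κ * r ^ (Dim x))) := by
    intro ε hε
    obtain ⟨d, U, ψ, c, θ, ⟨hUm, -, hcov, hbi, hc, -, hθ, hpush⟩, hdim⟩ := hDim.2 ε hε
    have hch := fun i => chart_bounds m ε hε.1 (d i) (U i) (hUm i) (ψ i) (c i) (hc i) (θ i)
      (hθ i) (hbi i) (hpush i)
    have hbad := measure_union_null hcov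
      (measure_union_null (measure_iUnion_null hdim) (measure_iUnion_null hch))
    rw [ae_iff]
    refine measure_mono_null ?_ hbad
    intro x hx
    by_cases hxU : x ∈ ⋃ i, U i
    · right
      obtain ⟨i, hi⟩ := mem_iUnion.1 hxU
      by_cases hd : Dim x = d i
      · right
        refine mem_iUnion.2 ⟨i, hi, ?_⟩
        rw [mem_setOf_eq, hd] at hx
        exact hx
      · left
        exact mem_iUnion.2 ⟨i, hi, hd⟩
    · left
      exact ⟨mem_univ _, hxU⟩
  have hall : ∀ᵐ x ∂m, ∀ n : ℕ, ∃ κ : ℝ, 0 < κ ∧ ∀ᶠ r in 𝓝[>] (0:ℝ),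
      ENNReal.ofReal (κ * r ^ (Dim x) / (1 + 1 / ((n:ℝ) + 1 + 1)) ^ (Dim x + 2))
        ≤ m (closedBall x r) ∧
      m (closedBall x r) ≤
        ENNReal.ofReal ((1 + 1 / ((n:ℝ) + 1 + 1)) ^ (Dim x + 2) * (κ * r ^ (Dim x))) := by
    rw [ae_all_iff]
    intro n
    refine hstep _ ⟨by positivity, ?_⟩
    rw [div_lt_one (by positivity)]
    have : (0:ℝ) ≤ n := Nat.cast_nonneg n
    linarith
  filter_upwards [hall] with x hx h hh
  set d := Dim x
  set L : ℕ → ℝ := fun n => (1 + 1 / ((n:ℝ) + 1 + 1)) ^ (d + 2) with hLdef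
  have hLpos : ∀ n, 0 < L n := fun n => by positivity
  have hL : Tendsto L atTop (𝓝 1) := by
    have h1 : Tendsto (fun n : ℕ => 1 / ((n:ℝ) + 1 + 1)) atTop (𝓝 0) := by
      have := (tendsto_add_atTop_iff_nat 1).2
        (tendsto_one_div_add_atTop_nhds_zero_nat (𝕜 := ℝ))
      simpa using this
    have h2 := (h1.const_add 1).pow (d + 2)
    simpa [hLdef] using h2
  have hb : ∀ n, ∀ᶠ r in 𝓝[>] (0:ℝ),
      ENNReal.ofReal (h ^ d / L n ^ 2) ≤ m (closedBall x (h * r)) / m (closedBall x r) ∧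
      m (closedBall x (h * r)) / m (closedBall x r) ≤ ENNReal.ofReal (L n ^ 2 * h ^ d) := by
    intro n
    obtain ⟨κ, hκ, H⟩ := hx n
    exact ratio_bounds m x (L n) κ (hLpos n) hκ d H h hh
  have hlo : Tendsto (fun n => ENNReal.ofReal (h ^ d / L n ^ 2)) atTop
      (𝓝 (ENNReal.ofReal h ^ d)) := by
    rw [← ENNReal.ofReal_pow hh.le]
    refine ENNReal.tendsto_ofReal ?_
    have := (tendsto_const_nhds (x := h ^ d)).div (hL.pow 2) (by norm_num)
    rw [one_pow, div_one] at this
    exact this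
  have hhi : Tendsto (fun n => ENNReal.ofReal (L n ^ 2 * h ^ d)) atTop
      (𝓝 (ENNReal.ofReal h ^ d)) := by
    rw [← ENNReal.ofReal_pow hh.le]
    refine ENNReal.tendsto_ofReal ?_
    have := (hL.pow 2).mul_const (h ^ d)
    simpa using this
  rw [tendsto_order]
  constructor
  · intro a ha
    obtain ⟨n, hn⟩ := (hlo.eventually (lt_mem_nhds ha)).exists
    filter_upwards [hb n] with r hr
    exact hn.trans_le hr.1
  · intro a ha
    obtain ⟨n, hn⟩ := (hhi.eventually (gt_mem_nhds ha)).exists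
    filter_upwards [hb n] with r hr
    exact hr.2.trans_lt hn

end BBM
end
end
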